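/- For every t > 0 and every integer k ≥ 0, setting s := t + k log 2, one has I_k(t) = 2^{−k(n+2)} ( I₀(s) + J_k(t) ), where J_k(t) := ∫_{Λ_s ∩ 𝒜₀} z·(B(s) − B(t))z dz; moreover there is a constant C_n < ∞ depending only on n such that |J_k(t)| ≤ C_n F₀(s) ∫_t^s F(τ) dτ. -/

import Mathlib

open MeasureTheory Metric Filter Topology Pointwise

noncomputable section

abbrev En (n : ℕ) := EuclideanSpace ℝ (Fin n)

/-- symmetric trace-free matrices -/
def S0 {n : ℕ} (B : Matrix (Fin n) (Fin n) ℝ) : Prop := B.IsSymm ∧ B.trace = 0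

/-- ψ_B(x) = (1/2) x·Bx -/
def psiM {n : ℕ} (B : Matrix (Fin n) (Fin n) ℝ) (x : En n) : ℝ :=
  (1/2) * ∑ i, ∑ j, B i j * x i * x j

/-- p₀(x) = |x|²/(2n) -/
def p0 (n : ℕ) (x : En n) : ℝ := ‖x‖^2 / (2*n)

/-- q_B = p₀ + ψ_B -/
def qB {n : ℕ} (B : Matrix (Fin n) (Fin n) ℝ) (x : En n) : ℝ := p0 n x + psiM B x

/-- surface measure on the unit sphere -/
def sphMeas (n : ℕ) : Measure (En n) :=
  (Measure.hausdorffMeasure ((n:ℝ) - 1)).restrict (sphere (0:En n) 1)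

/-- total surface area of the unit sphere -/
def sphArea (n : ℕ) : ℝ := (sphMeas n Set.univ).toReal

/-- u is a C^{1,1} solution of Δu = χ_{|∇u|>0} in B₁ with 0 a free boundary point. -/
def SolutionHyp {n : ℕ} (u : En n → ℝ) : Prop :=
  (∀ x ∈ ball (0:En n) 1, DifferentiableAt ℝ u x) ∧
  (∃ L : NNReal, LipschitzOnWith L (fun x => gradient u x) (ball (0:En n) 1)) ∧
  (∀ᵐ x ∂(volume.restrict (ball (0:En n) 1)),
      ∃ D : En n →L[ℝ] En n, HasFDerivAt (fun y => gradient u y) D x ∧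
        ((gradient u x = 0 → LinearMap.trace ℝ (En n) (D : En n →ₗ[ℝ] En n) = 0) ∧
         (gradient u x ≠ 0 → LinearMap.trace ℝ (En n) (D : En n →ₗ[ℝ] En n) = 1))) ∧
  ((0:En n) ∈ frontier {x | x ∈ ball (0:En n) 1 ∧ gradient u x ≠ 0}) ∧
  gradient u 0 = 0

/-- the quadratic rescaling u_t(x) = e^{2t}(u(e^{-t}x)-u(0)) -/
def ut {n : ℕ} (u : En n → ℝ) (t : ℝ) (x : En n) : ℝ :=
  Real.exp (2*t) * (u (Real.exp (-t) • x) - u 0)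

/-- Λ = {x ∈ B₁ : ∇u(x)=0} -/
def Lam {n : ℕ} (u : En n → ℝ) : Set (En n) :=
  {x | x ∈ ball (0:En n) 1 ∧ gradient u x = 0}

/-- Λ_t = e^t Λ -/
def LamT {n : ℕ} (u : En n → ℝ) (t : ℝ) : Set (En n) := Real.exp t • Lam u

/-- B(t) is the L²(∂B₁)-projection coefficient of u_t - p₀ -/
def BProp {n : ℕ} (u : En n → ℝ) (B : ℝ → Matrix (Fin n) (Fin n) ℝ) : Prop :=
  ∀ t, 0 < t → S0 (B t) ∧
    ∀ C, S0 C →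
      ∫ x, (ut u t x - p0 n x - psiM (B t) x) * psiM C x ∂(sphMeas n) = 0

/-- remainder R_t = u_t - q_{B(t)} -/
def Rt {n : ℕ} (u : En n → ℝ) (B : ℝ → Matrix (Fin n) (Fin n) ℝ) (t : ℝ) (x : En n) : ℝ :=
  ut u t x - qB (B t) x

/-- F(t) = ∫_{Λ_t ∩ B₁} |x|² dx -/
def Fdef {n : ℕ} (u : En n → ℝ) (t : ℝ) : ℝ :=
  ∫ x in LamT u t ∩ ball (0:En n) 1, ‖x‖^2

/-- I(t) = ∫_{Λ_t ∩ B₁} x·∇R_t dx -/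
def Idef {n : ℕ} (u : En n → ℝ) (B : ℝ → Matrix (Fin n) (Fin n) ℝ) (t : ℝ) : ℝ :=
  ∫ x in LamT u t ∩ ball (0:En n) 1, ∑ i, x i * gradient (Rt u B t) x i

/-- the origin is a singular point -/
def IsSingular {n : ℕ} (u : En n → ℝ) : Prop :=
  ∃ (r : ℕ → ℝ) (Bstar : Matrix (Fin n) (Fin n) ℝ),
    (∀ k, 0 < r k) ∧ Tendsto r atTop (nhds 0) ∧ S0 Bstar ∧
    (∀ K : Set (En n), IsCompact K →
      TendstoUniformlyOn (fun k x => (u (r k • x) - u 0) / (r k)^2) (qB Bstar) atTop K ∧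
      TendstoUniformlyOn (fun k x => gradient (fun y => (u (r k • y) - u 0) / (r k)^2) x)
        (fun x => gradient (qB Bstar) x) atTop K)

/-- Frobenius norm -/
def frob {n : ℕ} (M : Matrix (Fin n) (Fin n) ℝ) : ℝ := Real.sqrt (∑ i, ∑ j, (M i j)^2)

/-- the annulus 1/2 < |x| < 1 -/
def ann0 (n : ℕ) : Set (En n) := {x | 1/2 < ‖x‖ ∧ ‖x‖ < 1}

/-- the dyadic annulus 2^{-k-1} < |x| < 2^{-k} -/
def annK (n : ℕ) (k : ℕ) : Set (En n) :=
  {x | (2:ℝ)^(-(k:ℤ)-1) < ‖x‖ ∧ ‖x‖ < (2:ℝ)^(-(k:ℤ))}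

def F0 {n : ℕ} (u : En n → ℝ) (t : ℝ) : ℝ := ∫ x in LamT u t ∩ ann0 n, ‖x‖^2

def Fk {n : ℕ} (u : En n → ℝ) (k : ℕ) (t : ℝ) : ℝ := ∫ x in LamT u t ∩ annK n k, ‖x‖^2

def I0 {n : ℕ} (u : En n → ℝ) (B : ℝ → Matrix (Fin n) (Fin n) ℝ) (t : ℝ) : ℝ :=
  ∫ x in LamT u t ∩ ann0 n, ∑ i, x i * gradient (Rt u B t) x i

def Ik {n : ℕ} (u : En n → ℝ) (B : ℝ → Matrix (Fin n) (Fin n) ℝ) (k : ℕ) (t : ℝ) : ℝ :=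
  ∫ x in LamT u t ∩ annK n k, ∑ i, x i * gradient (Rt u B t) x i

/-- ε(t) = sup_{1/2 ≤ |x| ≤ 1} |∇R_t(x)| -/
def epsd {n : ℕ} (u : En n → ℝ) (B : ℝ → Matrix (Fin n) (Fin n) ℝ) (t : ℝ) : ℝ :=
  ⨆ x ∈ {x : En n | 1/2 ≤ ‖x‖ ∧ ‖x‖ ≤ 1}, ‖gradient (Rt u B t) x‖

/-- trace-free part of a matrix -/
def tf {n : ℕ} (M : Matrix (Fin n) (Fin n) ℝ) : Matrix (Fin n) (Fin n) ℝ :=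
  Matrix.of fun i j => M i j - (M.trace / n) * (if i = j then 1 else 0)

/-- second moment matrix of Λ_t ∩ B₁ -/
def momMat {n : ℕ} (u : En n → ℝ) (t : ℝ) : Matrix (Fin n) (Fin n) ℝ :=
  Matrix.of fun i j => ∫ x in LamT u t ∩ ball (0:En n) 1, x i * x j

/-- V(t) -/
def Vdef {n : ℕ} (u : En n → ℝ) (t : ℝ) : ℝ :=
  ∑' k : ℕ, (2:ℝ)^(-((k * (n+2) : ℕ) : ℤ)) * F0 u (t + k * Real.log 2) *
    ∫ τ in t..(t + k * Real.log 2), Fdef u τ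

theorem integral_mul_measureReal_univ_eq_of_ball_eq {X : Type*} [MetricSpace X] [CompactSpace X]
    [MeasurableSpace X] [BorelSpace X] (μ ν : Measure X) [IsFiniteMeasure μ] [IsFiniteMeasure ν]
    (hμ : ∀ x y r, μ (ball x r) = μ (ball y r)) (hν : ∀ x y r, ν (ball x r) = ν (ball y r))
    {f : X → ℝ} (hf : Continuous f) :
    ν.real Set.univ * ∫ x, f x ∂μ = μ.real Set.univ * ∫ x, f x ∂ν := by
  rcases isEmpty_or_nonempty X with hX | ⟨⟨x₀⟩⟩
  · simp [Measure.eq_zero_of_isEmpty μ, Measure.eq_zero_of_isEmpty ν]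
  rcases eq_or_ne ν 0 with rfl | hν0
  · simp
  have hpos : ∀ r > 0, 0 < ν.real (ball x₀ r) := by
    intro r hr
    rw [measureReal_def, ENNReal.toReal_pos_iff]
    refine ⟨pos_iff_ne_zero.2 fun h0 => hν0 ?_, measure_lt_top _ _⟩
    refine Measure.measure_univ_eq_zero.1 (measure_null_of_locally_null _ fun x _ => ?_)
    exact ⟨ball x r, mem_nhdsWithin_of_mem_nhds (ball_mem_nhds x hr), (hν x x₀ r).trans h0⟩
  obtain ⟨M, hM⟩ : ∃ M, ∀ x, ‖f x‖ ≤ M := by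
    obtain ⟨M, hM⟩ := (isCompact_range hf).isBounded.exists_norm_le
    exact ⟨M, fun x => hM _ ⟨x, rfl⟩⟩
  have key : ∀ ε > 0, |ν.real Set.univ * ∫ x, f x ∂μ - μ.real Set.univ * ∫ x, f x ∂ν|
      ≤ ε * (μ.real Set.univ * ν.real Set.univ) := by
    intro ε hε
    obtain ⟨r, hr, hfr⟩ := Metric.uniformContinuous_iff.1
      (CompactSpace.uniformContinuous_of_continuous hf) ε hε
    set k := ν.real (ball x₀ r) with hk
    set m := μ.real (ball x₀ r) with hm
    have hkpos : 0 < k := hpos r hr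
    let U : Set (X × X) := {p | dist p.1 p.2 < r}
    have hU : MeasurableSet U :=
      (isOpen_lt (continuous_fst.dist continuous_snd) continuous_const).measurableSet
    let χ : X × X → ℝ := U.indicator fun _ => 1
    have hχm : Measurable χ := measurable_const.indicator hU
    have hχ0 : ∀ p, 0 ≤ χ p := fun p => Set.indicator_nonneg (fun _ _ => zero_le_one) p
    have hχ1 : ∀ p, χ p ≤ 1 := fun p => Set.indicator_le_self' (fun _ _ => zero_le_one) p
    have hint : ∀ g : X × X → ℝ, Continuous g → (∃ K, ∀ p, ‖g p‖ ≤ K) →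
        Integrable (fun p => g p * χ p) (μ.prod ν) := by
      rintro g hg ⟨K, hK⟩
      refine Integrable.of_bound (hg.measurable.mul hχm).aestronglyMeasurable K
        (ae_of_all _ fun p => ?_)
      rw [norm_mul, Real.norm_of_nonneg (hχ0 p)]
      calc ‖g p‖ * χ p ≤ ‖g p‖ * 1 := by gcongr; exact hχ1 p
        _ ≤ K := by simpa using hK p
    have h1 : ∀ x, ∫ y, χ (x, y) ∂ν = k := by
      intro x
      have : (fun y => χ (x, y)) = (ball x r).indicator fun _ => 1 := by
        ext y
        simp [χ, U, Set.indicator, mem_ball, dist_comm]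
      rw [this, integral_indicator measurableSet_ball]
      simp [measureReal_def, hν x x₀ r, hk]
    have h2 : ∀ y, ∫ x, χ (x, y) ∂μ = m := by
      intro y
      have : (fun x => χ (x, y)) = (ball y r).indicator fun _ => 1 := by
        ext x
        simp [χ, U, Set.indicator, mem_ball]
      rw [this, integral_indicator measurableSet_ball]
      simp [measureReal_def, hμ y x₀ r, hm]
    have i1 := hint (fun p => f p.1) (by fun_prop) ⟨M, fun p => hM _⟩
    have i2 := hint (fun p => f p.2) (by fun_prop) ⟨M, fun p => hM _⟩
    have i0 := hint (fun p => 1) (by fun_prop) ⟨1, fun p => by simp⟩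
    simp only [one_mul] at i0
    have hA : ∫ p, f p.1 * χ p ∂(μ.prod ν) = k * ∫ x, f x ∂μ := by
      rw [integral_prod _ i1]
      simp_rw [integral_const_mul, h1, integral_mul_const]
      ring
    have hB : ∫ p, f p.2 * χ p ∂(μ.prod ν) = m * ∫ x, f x ∂ν := by
      rw [integral_prod_symm _ i2]
      simp_rw [integral_const_mul, h2, integral_mul_const]
      ring
    have hC : ∫ p, χ p ∂(μ.prod ν) = k * μ.real Set.univ := by
      rw [integral_prod _ i0]
      simp [h1, mul_comm]
    have hD : ∫ p, χ p ∂(μ.prod ν) = m * ν.real Set.univ := by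
      rw [integral_prod_symm _ i0]
      simp [h2, mul_comm]
    have hE : |k * ∫ x, f x ∂μ - m * ∫ x, f x ∂ν| ≤ ε * (k * μ.real Set.univ) := by
      rw [← hA, ← hB, ← hC, ← integral_sub i1 i2, ← integral_const_mul, ← Real.norm_eq_abs]
      refine norm_integral_le_of_norm_le (i0.const_mul ε) (ae_of_all _ fun p => ?_)
      rw [← sub_mul, norm_mul, Real.norm_of_nonneg (hχ0 p)]
      by_cases hp : p ∈ U
      · have := hfr hp
        rw [Real.dist_eq] at this
        exact mul_le_mul_of_nonneg_right this.le (hχ0 p)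
      · simp [χ, hp]
    rw [hC] at hD
    have : k * |ν.real Set.univ * ∫ x, f x ∂μ - μ.real Set.univ * ∫ x, f x ∂ν|
        = ν.real Set.univ * |k * ∫ x, f x ∂μ - m * ∫ x, f x ∂ν| := by
      rw [← abs_of_pos hkpos, ← abs_mul, abs_of_pos hkpos,
        ← abs_of_nonneg (measureReal_nonneg (μ := ν) (s := Set.univ)), ← abs_mul,
        abs_of_nonneg (measureReal_nonneg (μ := ν) (s := Set.univ))]
      congr 1
      linear_combination (-∫ x, f x ∂ν) * hD
    refine le_of_mul_le_mul_left ?_ hkpos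
    rw [this]
    calc _ ≤ ν.real Set.univ * (ε * (k * μ.real Set.univ)) := by gcongr
      _ = _ := by ring
  have : |ν.real Set.univ * ∫ x, f x ∂μ - μ.real Set.univ * ∫ x, f x ∂ν| ≤ 0 := by
    refine le_of_forall_pos_le_add fun δ hδ => ?_
    set T := μ.real Set.univ * ν.real Set.univ
    have hT : 0 ≤ T := by positivity
    refine (key (δ / (T + 1)) (by positivity)).trans ?_
    rw [zero_add, div_mul_eq_mul_div, div_le_iff₀ (by positivity)]
    nlinarith
  exact sub_eq_zero.1 (abs_nonpos_iff.1 this)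

section SphereMeasure

variable {E : Type*} [NormedAddCommGroup E] [InnerProductSpace ℝ E]

theorem exists_linearIsometryEquiv_image_sphere_ball (x y : sphere (0 : E) 1) (r : ℝ) :
    ∃ φ : E ≃ₗᵢ[ℝ] E, φ '' ((↑) '' ball x r) = ((↑) '' ball y r : Set E) := by
  have hxy : ‖(x : E)‖ = ‖(y : E)‖ := by simp
  refine ⟨(Submodule.span ℝ {(x : E) - y})ᗮ.reflection, ?_⟩
  set φ := (Submodule.span ℝ {(x : E) - y})ᗮ.reflection
  have hφ : φ x = y := Submodule.reflection_sub hxy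
  have hφ' : φ.symm y = x := by rw [← hφ, φ.symm_apply_apply]
  ext z
  constructor
  · rintro ⟨_, ⟨w, hw, rfl⟩, rfl⟩
    refine ⟨⟨φ w, by simp⟩, ?_, rfl⟩
    rw [mem_ball, Subtype.dist_eq] at hw ⊢
    rwa [← hφ, φ.dist_map]
  · rintro ⟨w, hw, rfl⟩
    refine ⟨φ.symm w, ⟨⟨φ.symm w, by simp⟩, ?_, rfl⟩, by simp⟩
    rw [mem_ball, Subtype.dist_eq] at hw ⊢
    rwa [← hφ', φ.symm.dist_map]

theorem orthogonal_add_sqrt_smul_eq (v : E) (hv : ‖v‖ = 1) (y : E) (hy : ‖y‖ = 1)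
    (hvy : 0 ≤ inner ℝ v y) :
    y = ((Submodule.span ℝ {v})ᗮ.orthogonalProjectionOnto y : E) +
      Real.sqrt (1 - ‖(Submodule.span ℝ {v})ᗮ.orthogonalProjectionOnto y‖ ^ 2) • v := by
  set w := (Submodule.span ℝ {v})ᗮ.orthogonalProjectionOnto y with hw
  have h1 : y = inner ℝ v y • v + (w : E) := by
    conv_lhs => rw [← Submodule.starProjection_add_starProjection_orthogonal
      (K := Submodule.span ℝ {v}) y, Submodule.starProjection_unit_singleton ℝ hv]
    rfl
  have h0 : inner ℝ v (w : E) = 0 :=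
    Submodule.mem_orthogonal_singleton_iff_inner_right.1 w.2
  have h2 : ‖y‖ * ‖y‖ = inner ℝ v y * inner ℝ v y + ‖w‖ * ‖w‖ := by
    conv_lhs => rw [h1]
    rw [norm_add_sq_eq_norm_sq_add_norm_sq_real (by rw [inner_smul_left, h0, mul_zero]),
      norm_smul, hv, mul_one, Real.norm_of_nonneg hvy]
    rfl
  have h3 : 1 - ‖w‖ ^ 2 = inner ℝ v y ^ 2 := by rw [hy] at h2; linarith
  rw [h3, Real.sqrt_sq hvy, add_comm]
  exact h1

variable [MeasurableSpace E] [BorelSpace E]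

theorem hausdorffMeasure_sphere_ball_eq {d : ℝ} (hd : 0 ≤ d) (x y : sphere (0 : E) 1) (r : ℝ) :
    Measure.hausdorffMeasure d (ball x r) = Measure.hausdorffMeasure d (ball y r) := by
  obtain ⟨φ, hφ⟩ := exists_linearIsometryEquiv_image_sphere_ball x y r
  rw [← (isometry_subtype_coe (s := sphere (0 : E) 1)).hausdorffMeasure_image (Or.inl hd),
    ← (isometry_subtype_coe (s := sphere (0 : E) 1)).hausdorffMeasure_image (Or.inl hd), ← hφ,
    φ.isometry.hausdorffMeasure_image (Or.inl hd)]

variable [FiniteDimensional ℝ E]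

theorem toSphere_ball_eq (x y : sphere (0 : E) 1) (r : ℝ) :
    (volume : Measure E).toSphere (ball x r) = (volume : Measure E).toSphere (ball y r) := by
  obtain ⟨φ, hφ⟩ := exists_linearIsometryEquiv_image_sphere_ball x y r
  rw [Measure.toSphere_apply' _ measurableSet_ball, Measure.toSphere_apply' _ measurableSet_ball,
    ← hφ]
  congr 1
  have h : Set.Ioo (0 : ℝ) 1 • (φ '' ((↑) '' ball x r)) =
      φ '' (Set.Ioo (0 : ℝ) 1 • ((↑) '' ball x r : Set E)) := by
    ext z
    simp only [Set.mem_smul, Set.mem_image]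
    constructor
    · rintro ⟨a, ha, _, ⟨b, hb, rfl⟩, rfl⟩
      exact ⟨a • b, ⟨a, ha, b, hb, rfl⟩, by simp⟩
    · rintro ⟨_, ⟨a, ha, b, hb, rfl⟩, rfl⟩
      exact ⟨a, ha, φ b, ⟨b, hb, rfl⟩, by simp⟩
  have h2 := (LinearIsometryEquiv.measurePreserving φ).measure_preimage_emb
    φ.toHomeomorph.measurableEmbedding
    (φ '' (Set.Ioo (0 : ℝ) 1 • ((↑) '' ball x r : Set E)))
  rw [Set.preimage_image_eq _ φ.injective] at h2
  rw [h, h2]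

variable {d : ℕ}

theorem hausdorffMeasure_sphere_univ_lt_top (hE : Module.finrank ℝ E = d + 1) :
    Measure.hausdorffMeasure (d : ℝ) (Set.univ : Set (sphere (0 : E) 1)) < ⊤ := by
  have : Fact (Module.finrank ℝ E = d + 1) := ⟨hE⟩
  refine isCompact_univ.measure_lt_top_of_nhdsWithin fun x _ => ?_
  rw [nhdsWithin_univ]
  have hv : ‖(x : E)‖ = 1 := by simp
  have hv0 : (x : E) ≠ 0 := by rw [← norm_ne_zero_iff, hv]; exact one_ne_zero
  let P := (Submodule.span ℝ {(x : E)})ᗮ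
  have hP : Module.finrank ℝ P = d := Submodule.finrank_orthogonal_span_singleton hv0
  let g : P → E := fun w => (w : E) + Real.sqrt (1 - ‖w‖ ^ 2) • (x : E)
  have hg : ContDiffAt ℝ 1 g 0 := by
    refine ContDiffAt.add P.subtypeL.contDiff.contDiffAt (ContDiffAt.smul ?_ contDiffAt_const)
    refine ContDiffAt.sqrt ?_ (by simp)
    exact contDiffAt_const.sub (contDiff_norm_sq ℝ).contDiffAt
  obtain ⟨K, t, ht, hK⟩ := hg.exists_lipschitzOnWith
  have hK' : LipschitzOnWith K g (t ∩ closedBall 0 1) := hK.mono Set.inter_subset_left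
  have hfin : Measure.hausdorffMeasure (d : ℝ) (g '' (t ∩ closedBall 0 1)) < ⊤ := by
    refine (hK'.hausdorffMeasure_image_le (Nat.cast_nonneg d)).trans_lt ?_
    refine ENNReal.mul_lt_top (ENNReal.rpow_lt_top_of_nonneg (Nat.cast_nonneg d) (by simp)) ?_
    rw [← hP]
    exact (measure_mono Set.inter_subset_right).trans_lt
      (isCompact_closedBall (0 : P) 1).measure_lt_top
  have hcont : Continuous fun y : sphere (0 : E) 1 => P.orthogonalProjectionOnto (y : E) := by
    fun_prop
  have hx0 : P.orthogonalProjectionOnto (x : E) = 0 := by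
    rw [Submodule.orthogonalProjectionOnto_eq_zero_iff, Submodule.orthogonal_orthogonal]
    exact Submodule.mem_span_singleton_self _
  refine ⟨{y | P.orthogonalProjectionOnto (y : E) ∈ t ∩ closedBall 0 1} ∩
    {y | 0 < inner ℝ (x : E) (y : E)}, inter_mem ?_ ?_, ?_⟩
  · refine hcont.continuousAt.preimage_mem_nhds ?_
    rw [hx0]
    exact inter_mem ht (closedBall_mem_nhds _ one_pos)
  · refine (isOpen_lt continuous_const (by fun_prop)).mem_nhds ?_
    simp [hv]
  · rw [← (isometry_subtype_coe (s := sphere (0 : E) 1)).hausdorffMeasure_image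
      (Or.inl (Nat.cast_nonneg d))]
    refine (measure_mono ?_).trans_lt hfin
    rintro _ ⟨y, ⟨hy1, hy2⟩, rfl⟩
    exact ⟨_, hy1, (orthogonal_add_sqrt_smul_eq _ hv (y : E) (by simp) (le_of_lt hy2)).symm⟩

theorem hausdorffMeasure_sphere_univ_pos (hE : Module.finrank ℝ E = d + 1) :
    0 < Measure.hausdorffMeasure (d : ℝ) (Set.univ : Set (sphere (0 : E) 1)) := by
  have : Fact (Module.finrank ℝ E = d + 1) := ⟨hE⟩
  have : Nontrivial E := Module.nontrivial_of_finrank_pos (R := ℝ) (by omega)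
  obtain ⟨v, hv⟩ := exists_norm_eq E (zero_le_one (α := ℝ))
  have hv0 : v ≠ 0 := by rw [← norm_ne_zero_iff, hv]; exact one_ne_zero
  let P := (Submodule.span ℝ {v})ᗮ
  have hP : Module.finrank ℝ P = d := Submodule.finrank_orthogonal_span_singleton hv0
  have hpos : 0 < Measure.hausdorffMeasure (d : ℝ) (ball (0 : P) 1) := by
    rw [← hP]
    exact measure_ball_pos _ _ one_pos
  rw [← (isometry_subtype_coe (s := sphere (0 : E) 1)).hausdorffMeasure_image
      (Or.inl (Nat.cast_nonneg d)), Set.image_univ, Subtype.range_coe]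
  refine hpos.trans_le ((measure_mono ?_).trans
    ((P.lipschitzWith_orthogonalProjectionOnto.hausdorffMeasure_image_le
      (Nat.cast_nonneg d) (sphere (0 : E) 1)).trans (by simp)))
  intro w hw
  have hw1 : ‖w‖ ≤ 1 := by simpa using (mem_ball_zero_iff.1 hw).le
  have hw2 : 0 ≤ 1 - ‖w‖ ^ 2 := by nlinarith [norm_nonneg w]
  have h0 : inner ℝ v (w : E) = 0 :=
    Submodule.mem_orthogonal_singleton_iff_inner_right.1 w.2
  refine ⟨(w : E) + Real.sqrt (1 - ‖w‖ ^ 2) • v, ?_, ?_⟩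
  · rw [mem_sphere_zero_iff_norm]
    have h1 := norm_add_sq_eq_norm_sq_add_norm_sq_real (x := (w : E))
      (y := Real.sqrt (1 - ‖w‖ ^ 2) • v)
      (by rw [inner_smul_right, real_inner_comm, h0, mul_zero])
    rw [norm_smul, hv, mul_one, Real.norm_of_nonneg (Real.sqrt_nonneg _),
      Real.mul_self_sqrt hw2] at h1
    have h2 : ‖(w : E)‖ = ‖w‖ := rfl
    rw [h2] at h1
    have h3 : ‖(w : E) + Real.sqrt (1 - ‖w‖ ^ 2) • v‖ ^ 2 = 1 := by nlinarith
    exact (pow_eq_one_iff_of_nonneg (norm_nonneg _) two_ne_zero).1 h3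
  · rw [map_add, map_smul]
    have : P.orthogonalProjectionOnto v = 0 := by
      rw [Submodule.orthogonalProjectionOnto_eq_zero_iff, Submodule.orthogonal_orthogonal]
      exact Submodule.mem_span_singleton_self _
    rw [this, smul_zero, add_zero]
    simp

end SphereMeasure

theorem exists_pos_integral_sphMeas_eq (n : ℕ) (hn : 2 ≤ n) :
    ∃ c : ℝ, 0 < c ∧ ∀ f : En n → ℝ, ContinuousOn f (sphere 0 1) →
      ∫ x, f x ∂(sphMeas n) = c * ∫ x, f (x : En n) ∂(volume : Measure (En n)).toSphere := by
  obtain ⟨d, rfl⟩ : ∃ d, n = d + 1 := ⟨n - 1, by omega⟩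
  have hE : Module.finrank ℝ (En (d + 1)) = d + 1 := by simp
  have : Nontrivial (En (d + 1)) := Module.nontrivial_of_finrank_pos (R := ℝ) (by omega)
  set κ : Measure (sphere (0 : En (d + 1)) 1) := Measure.hausdorffMeasure (d : ℝ) with hκ
  have : IsFiniteMeasure κ := ⟨hausdorffMeasure_sphere_univ_lt_top hE⟩
  set σ := (volume : Measure (En (d + 1))).toSphere with hσ
  have hσpos : 0 < σ.real Set.univ := by
    rw [measureReal_def, ENNReal.toReal_pos_iff]
    exact ⟨pos_iff_ne_zero.2 fun h => Measure.toSphere_ne_zero (volume : Measure (En (d + 1)))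
      (Measure.measure_univ_eq_zero.1 h), measure_lt_top _ _⟩
  have hκpos : 0 < κ.real Set.univ := by
    rw [measureReal_def, ENNReal.toReal_pos_iff]
    exact ⟨hausdorffMeasure_sphere_univ_pos hE, measure_lt_top _ _⟩
  have hmap : sphMeas (d + 1) = κ.map (↑) := by
    rw [hκ, (isometry_subtype_coe (s := sphere (0 : En (d + 1)) 1)).map_hausdorffMeasure
      (Or.inl (Nat.cast_nonneg d)), Subtype.range_coe, sphMeas]
    simp
  refine ⟨κ.real Set.univ / σ.real Set.univ, by positivity, fun f hf => ?_⟩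
  rw [hmap, (MeasurableEmbedding.subtype_coe isClosed_sphere.measurableSet).integral_map]
  have := integral_mul_measureReal_univ_eq_of_ball_eq κ σ
    (hausdorffMeasure_sphere_ball_eq (Nat.cast_nonneg d)) toSphere_ball_eq
    (continuousOn_iff_continuous_domRestrict.1 hf)
  simp only [Set.domRestrict_apply] at this
  field_simp
  linarith

theorem integral_eq_integral_toSphere {E : Type*} [NormedAddCommGroup E] [NormedSpace ℝ E]
    [FiniteDimensional ℝ E] [MeasurableSpace E] [BorelSpace E] [Nontrivial E]
    (μ : Measure E) [μ.IsAddHaarMeasure] {f : E → ℝ} (hf : Integrable f μ) :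
    ∫ x, f x ∂μ = ∫ ω, (∫ r in Set.Ioi (0 : ℝ),
      r ^ (Module.finrank ℝ E - 1) * f (r • (ω : E))) ∂μ.toSphere := by
  have hmp := (Measure.measurePreserving_homeomorphUnitSphereProd μ).symm
    (homeomorphUnitSphereProd E).toMeasurableEquiv
  have hemb2 := (homeomorphUnitSphereProd E).toMeasurableEquiv.symm.measurableEmbedding
  have h1 : ∫ x, f x ∂μ = ∫ x : ({0}ᶜ : Set E), f x ∂(μ.comap (↑)) := by
    rw [integral_subtype_comap (measurableSet_singleton _).compl f, restrict_compl_singleton]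
  have h2 : Integrable (fun x : ({0}ᶜ : Set E) => f x) (μ.comap (↑)) :=
    (integrableOn_iff_comap_subtypeVal (measurableSet_singleton (0 : E)).compl).1 hf.integrableOn
  have h3 := (hmp.integrable_comp_emb hemb2).2 h2
  simp only [Function.comp_def] at h3
  rw [h1, ← hmp.integral_comp hemb2, integral_prod _ h3]
  refine integral_congr_ae (ae_of_all _ fun ω => ?_)
  simp only [Measure.volumeIoiPow, ENNReal.ofReal]
  rw [integral_withDensity_eq_integral_smul
    ((measurable_subtype_coe.pow_const _).real_toNNReal)]
  have h4 := integral_subtype_comap (μ := (volume : Measure ℝ)) (measurableSet_Ioi (a := (0 : ℝ)))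
    fun r => r ^ (Module.finrank ℝ E - 1) * f (r • (ω : E))
  rw [← h4]
  refine integral_congr_ae (ae_of_all _ fun r => ?_)
  simp only [NNReal.smul_def, Real.coe_toNNReal _ (pow_nonneg r.2.out.le _), smul_eq_mul]
  rfl

section Divergence

variable {E : Type*} [NormedAddCommGroup E] [InnerProductSpace ℝ E]

theorem LipschitzOnWith.smul_of_norm_le {s : Set E} {a : E → ℝ} {b : E → E} {K L M N : NNReal}
    (ha : LipschitzOnWith K a s) (hb : LipschitzOnWith L b s)
    (hM : ∀ x ∈ s, ‖a x‖ ≤ M) (hN : ∀ x ∈ s, ‖b x‖ ≤ N) :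
    LipschitzOnWith (M * L + K * N) (fun x => a x • b x) s := by
  refine LipschitzOnWith.of_dist_le_mul fun x hx y hy => ?_
  have h1 := ha.dist_le_mul x hx y hy
  have h2 := hb.dist_le_mul x hx y hy
  rw [dist_eq_norm] at h1 h2 ⊢
  have h3 : a x • b x - a y • b y = a x • (b x - b y) + (a x - a y) • b y := by
    rw [smul_sub, sub_smul]; abel
  rw [h3]
  calc _ ≤ ‖a x‖ * ‖b x - b y‖ + ‖a x - a y‖ * ‖b y‖ := by
        refine (norm_add_le _ _).trans ?_
        rw [norm_smul, norm_smul]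
    _ ≤ M * (L * dist x y) + (K * dist x y) * N := by
        gcongr
        · exact hM x hx
        · exact hN y hy
    _ = _ := by push_cast; ring

variable [FiniteDimensional ℝ E]

theorem lipschitzOnWith_of_hasGradientAt {s : Set E} (hs : Convex ℝ s) {f : E → ℝ} {g : E → E}
    {M : NNReal} (hf : ∀ x ∈ s, HasGradientAt f (g x) x) (hM : ∀ x ∈ s, ‖g x‖ ≤ M) :
    LipschitzOnWith M f s := by
  refine hs.lipschitzOnWith_of_nnnorm_hasFDerivWithin_le
    (fun x hx => (hf x hx).hasFDerivAt.hasFDerivWithinAt) fun x hx => ?_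
  rw [← NNReal.coe_le_coe]
  simpa using hM x hx

variable [MeasurableSpace E] [BorelSpace E]

/-- The divergence theorem for a Lipschitz vector field on the unit ball tested against a Lipschitz
function supported in the ball. -/
theorem setIntegral_ball_div_mul_eq {X : E → E} {K D : NNReal} {g divX : E → ℝ} {dg : E → E}
    (hX : LipschitzOnWith K X (ball 0 1)) (hg : LipschitzWith D g) (hgc : HasCompactSupport g)
    (hg0 : ∀ x, x ∉ ball (0 : E) 1 → g x = 0) (hdg0 : ∀ x, x ∉ ball (0 : E) 1 → dg x = 0)
    (hdg : ∀ᵐ x, HasGradientAt g (dg x) x)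
    (hdiv : ∀ᵐ x ∂(volume.restrict (ball (0 : E) 1)), ∃ A : E →L[ℝ] E, HasFDerivAt X A x ∧
      LinearMap.trace ℝ E (A : E →ₗ[ℝ] E) = divX x) :
    ∫ x in ball (0 : E) 1, divX x * g x = - ∫ x in ball (0 : E) 1, inner ℝ (X x) (dg x) := by
  let b := stdOrthonormalBasis ℝ E
  have hXi : ∀ i, ∃ Y : E → ℝ, LipschitzWith K Y ∧
      Set.EqOn (fun x => inner ℝ (b i) (X x)) Y (ball 0 1) := by
    intro i
    refine LipschitzOnWith.extend_real (LipschitzOnWith.of_dist_le_mul fun x hx y hy => ?_)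
    refine le_trans ?_ (hX.dist_le_mul x hx y hy)
    rw [Real.dist_eq, ← inner_sub_right, dist_eq_norm]
    simpa using abs_real_inner_le_norm (b i) (X x - X y)
  choose Y hYL hYX using hXi
  have hI := fun i => (hYL i).integral_lineDeriv_mul_eq (μ := volume) hg hgc (b i)
  have hgi : Integrable g := hg.continuous.integrable_of_hasCompactSupport hgc
  have hline : ∀ᵐ x, ∀ v, lineDeriv ℝ g x v = inner ℝ (dg x) v := by
    filter_upwards [hdg] with x hx v
    rw [(hx.hasFDerivAt.hasLineDerivAt v).lineDeriv]
    simp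
  have i1 : ∀ i, Integrable fun x => lineDeriv ℝ (Y i) x (b i) * g x := by
    intro i
    refine hgi.bdd_mul (c := K * ‖b i‖)
      (measurable_lineDeriv (hYL i).continuous).aestronglyMeasurable (ae_of_all _ fun x => ?_)
    exact norm_lineDeriv_le_of_lipschitz ℝ (hYL i)
  have i2 : ∀ i, IntegrableOn (fun x => lineDeriv ℝ g x (-b i) * Y i x) (ball 0 1) := by
    intro i
    have : IntegrableOn (Y i) (ball 0 1) :=
      ((hYL i).continuous.continuousOn.integrableOn_compact (isCompact_closedBall 0 1)).mono_set
        ball_subset_closedBall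
    refine Integrable.bdd_mul (c := D * ‖-b i‖) this
      (measurable_lineDeriv hg.continuous).aestronglyMeasurable (ae_of_all _ fun x => ?_)
    exact norm_lineDeriv_le_of_lipschitz ℝ hg
  have e1 : ∑ i, ∫ x, lineDeriv ℝ (Y i) x (b i) * g x = ∫ x in ball (0 : E) 1, divX x * g x := by
    rw [← integral_finsetSum _ fun i _ => i1 i]
    rw [← setIntegral_eq_integral_of_forall_compl_eq_zero (s := ball (0 : E) 1)
      (fun x hx => by simp [hg0 x hx])]
    refine integral_congr_ae ?_
    filter_upwards [hdiv, ae_restrict_mem measurableSet_ball] with x ⟨A, hA, htr⟩ hx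
    rw [← Finset.sum_mul, ← htr, LinearMap.trace_eq_sum_inner _ b]
    congr 1
    refine Finset.sum_congr rfl fun i _ => ?_
    have h1 : HasFDerivAt (fun x => inner ℝ (b i) (X x)) ((innerSL ℝ (b i)).comp A) x :=
      (innerSL ℝ (b i)).hasFDerivAt.comp x hA
    have h2 : HasFDerivAt (Y i) ((innerSL ℝ (b i)).comp A) x :=
      h1.congr_of_eventuallyEq (by
        filter_upwards [isOpen_ball.mem_nhds hx] with y hy using (hYX i hy).symm)
    rw [(h2.hasLineDerivAt (b i)).lineDeriv]
    simp
  have e2 : ∑ i, ∫ x, lineDeriv ℝ g x (-b i) * Y i x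
      = - ∫ x in ball (0 : E) 1, inner ℝ (X x) (dg x) := by
    rw [← integral_neg]
    have : ∀ i, ∫ x, lineDeriv ℝ g x (-b i) * Y i x =
        ∫ x in ball (0 : E) 1, lineDeriv ℝ g x (-b i) * Y i x := by
      intro i
      rw [setIntegral_eq_integral_of_ae_compl_eq_zero]
      filter_upwards [hline] with x hx hxb
      simp [hx, hdg0 x hxb]
    rw [Finset.sum_congr rfl fun i _ => this i, ← integral_finsetSum _ fun i _ => i2 i]
    refine integral_congr_ae ?_
    filter_upwards [ae_restrict_of_ae hline, ae_restrict_mem measurableSet_ball] with x hx hxb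
    rw [← b.sum_inner_mul_inner, ← Finset.sum_neg_distrib]
    refine Finset.sum_congr rfl fun i _ => ?_
    have hY : inner ℝ (b i) (X x) = Y i x := hYX i hxb
    rw [hx, ← hY, inner_neg_right, real_inner_comm (b i) (dg x),
      real_inner_comm (X x) (b i)]
    ring
  rw [← e1, ← e2]
  exact Finset.sum_congr rfl fun i _ => hI i

end Divergence

/-- The radial cutoff `∫_ρ^b s^{-m-1} ds` for `a ≤ ρ ≤ b`, extended by constants. -/
def radialCutoff (m : ℕ) (a b ρ : ℝ) : ℝ :=
  ((max a (min b ρ)) ^ m)⁻¹ / m - (b ^ m)⁻¹ / m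

theorem hasDerivAt_inv_pow_div {m : ℕ} (hm : m ≠ 0) {s : ℝ} (hs : s ≠ 0) :
    HasDerivAt (fun s : ℝ => (s ^ m)⁻¹ / m) (-(s ^ (m + 1))⁻¹) s := by
  have h := ((hasDerivAt_pow m s).inv (pow_ne_zero m hs)).div_const (m : ℝ)
  refine h.congr_deriv ?_
  obtain ⟨k, rfl⟩ := Nat.exists_eq_succ_of_ne_zero hm
  have : ((k + 1 : ℕ) : ℝ) ≠ 0 := by positivity
  simp only [Nat.succ_eq_add_one, add_tsub_cancel_right] at *
  field_simp
  ring

theorem radialCutoff_of_le {m : ℕ} {a b ρ : ℝ} (hab : a ≤ b) (h : b ≤ ρ) :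
    radialCutoff m a b ρ = 0 := by
  simp [radialCutoff, min_eq_left h, max_eq_right hab]

theorem radialCutoff_of_mem {m : ℕ} {a b ρ : ℝ} (h1 : a ≤ ρ) (h2 : ρ ≤ b) :
    radialCutoff m a b ρ = (ρ ^ m)⁻¹ / m - (b ^ m)⁻¹ / m := by
  simp [radialCutoff, min_eq_right h2, max_eq_right h1]

theorem radialCutoff_of_ge {m : ℕ} {a b ρ : ℝ} (hab : a ≤ b) (h : ρ ≤ a) :
    radialCutoff m a b ρ = (a ^ m)⁻¹ / m - (b ^ m)⁻¹ / m := by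
  simp [radialCutoff, min_eq_right (h.trans hab), max_eq_left h]

theorem radialCutoff_nonneg {m : ℕ} {a b : ℝ} (ha : 0 < a) (hab : a ≤ b) (ρ : ℝ) :
    0 ≤ radialCutoff m a b ρ := by
  have h1 : 0 < max a (min b ρ) := lt_max_of_lt_left ha
  have h2 : max a (min b ρ) ≤ b := max_le hab (min_le_left _ _)
  rw [radialCutoff, sub_nonneg]
  gcongr

theorem radialCutoff_lipschitzWith {m : ℕ} (hm : m ≠ 0) {a : ℝ} (b : ℝ) (ha : 0 < a) :
    ∃ K, LipschitzWith K (radialCutoff m a b) := by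
  have h1 : LipschitzOnWith (((a ^ (m + 1))⁻¹).toNNReal) (fun s : ℝ => (s ^ m)⁻¹ / m)
      (Set.Ici a) := by
    refine (convex_Ici a).lipschitzOnWith_of_nnnorm_hasDerivWithin_le
      (fun s hs => (hasDerivAt_inv_pow_div hm (ha.trans_le hs).ne').hasDerivWithinAt)
      fun s hs => ?_
    have hs0 : 0 < s := ha.trans_le hs
    rw [← NNReal.coe_le_coe, coe_nnnorm, norm_neg, Real.norm_of_nonneg (by positivity),
      Real.coe_toNNReal _ (by positivity)]
    gcongr
    exact hs
  have h2 : LipschitzWith 1 fun ρ : ℝ => max a (min b ρ) :=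
    (LipschitzWith.id.const_min b).const_max a
  have h3 := h1.comp (h2.lipschitzOnWith (s := Set.univ)) (fun ρ _ => Set.mem_Ici.2 (le_max_left _ _))
  rw [lipschitzOnWith_univ] at h3
  refine ⟨_, h3.sub (LipschitzWith.const ((b ^ m)⁻¹ / m))⟩

section Core

variable {E : Type*} [NormedAddCommGroup E] [InnerProductSpace ℝ E]

theorem hasFDerivAt_half_inner (T : E →L[ℝ] E) (hT : (T : E →ₗ[ℝ] E).IsSymmetric) (x : E) :
    HasFDerivAt (fun x => (1 / 2 : ℝ) * inner ℝ x (T x)) (innerSL ℝ (T x)) x := by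
  have h := ((hasFDerivAt_id x).inner ℝ (T.hasFDerivAt (x := x))).const_mul (1 / 2 : ℝ)
  refine h.congr_fderiv ?_
  ext v
  have h1 : inner ℝ (T x) v = inner ℝ x (T v) := hT x v
  simp [h1, real_inner_comm (T x) v]
  ring

variable [FiniteDimensional ℝ E]

theorem hasGradientAt_radialCutoff {m : ℕ} (hm : m ≠ 0) {a b : ℝ} (ha : 0 < a) (hab : a ≤ b) {x : E}
    (hxa : ‖x‖ ≠ a) (hxb : ‖x‖ ≠ b) :
    HasGradientAt (fun x : E => radialCutoff m a b ‖x‖)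
      ({x : E | a < ‖x‖ ∧ ‖x‖ < b}.indicator (fun x => -(‖x‖ ^ (m + 2))⁻¹ • x) x) x := by
  rw [hasGradientAt_iff_hasFDerivAt]
  rcases lt_or_gt_of_ne hxa with h | h
  · have hx : x ∉ {x : E | a < ‖x‖ ∧ ‖x‖ < b} := fun h' => lt_asymm h h'.1
    rw [Set.indicator_of_notMem hx, map_zero]
    refine (hasFDerivAt_const ((a ^ m)⁻¹ / m - (b ^ m)⁻¹ / m) x).congr_of_eventuallyEq ?_
    filter_upwards [(isOpen_lt continuous_norm continuous_const).mem_nhds h] with y hy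
    exact radialCutoff_of_ge hab (le_of_lt hy)
  rcases lt_or_gt_of_ne hxb with h' | h'
  · rw [Set.indicator_of_mem (show x ∈ {x : E | a < ‖x‖ ∧ ‖x‖ < b} from ⟨h, h'⟩)]
    have hpos : 0 < ‖x‖ := ha.trans h
    have hx0 : x ≠ 0 := norm_pos_iff.1 hpos
    have hn : HasFDerivAt (fun y : E => ‖y‖) (‖x‖⁻¹ • innerSL ℝ x) x := by
      have h1 := ((hasStrictFDerivAt_norm_sq x).hasFDerivAt).sqrt (by positivity)
      simp only [Real.sqrt_sq (norm_nonneg _)] at h1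
      refine h1.congr_fderiv ?_
      ext v
      simp
      field_simp
    have h2 := (hasDerivAt_inv_pow_div hm hpos.ne').comp_hasFDerivAt x hn
    have h3 : HasFDerivAt (fun x : E => radialCutoff m a b ‖x‖)
        (-(‖x‖ ^ (m + 1))⁻¹ • (‖x‖⁻¹ • innerSL ℝ x)) x := by
      refine (h2.sub_const ((b ^ m)⁻¹ / m)).congr_of_eventuallyEq ?_
      filter_upwards [(isOpen_lt continuous_const continuous_norm).mem_nhds h,
        (isOpen_lt continuous_norm continuous_const).mem_nhds h'] with y hy hy'
      exact radialCutoff_of_mem (le_of_lt hy) (le_of_lt hy')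
    refine h3.congr_fderiv ?_
    ext v
    simp
    field_simp
    ring
  · have hx : x ∉ {x : E | a < ‖x‖ ∧ ‖x‖ < b} := fun h'' => lt_asymm h' h''.2
    rw [Set.indicator_of_notMem hx, map_zero]
    refine (hasFDerivAt_const (0 : ℝ) x).congr_of_eventuallyEq ?_
    filter_upwards [(isOpen_lt continuous_const continuous_norm).mem_nhds h'] with y hy
    exact radialCutoff_of_le hab (le_of_lt hy)

/-- The divergence of `ψ ∇w - (w - w(0)) ∇ψ` for a harmonic quadratic form `ψ`. -/
theorem exists_hasFDerivAt_trace_eq (T : E →L[ℝ] E) (hT : (T : E →ₗ[ℝ] E).IsSymmetric)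
    (hT0 : LinearMap.trace ℝ E (T : E →ₗ[ℝ] E) = 0) {w : E → ℝ} {G : E → E} {x : E}
    {A : E →L[ℝ] E} (c : ℝ) (hw : HasGradientAt w (G x) x) (hA : HasFDerivAt G A x) :
    ∃ A' : E →L[ℝ] E, HasFDerivAt
      (fun x => ((1 / 2 : ℝ) * inner ℝ x (T x)) • G x - (w x - c) • T x) A' x ∧
      LinearMap.trace ℝ E (A' : E →ₗ[ℝ] E) =
        (1 / 2 * inner ℝ x (T x)) * LinearMap.trace ℝ E (A : E →ₗ[ℝ] E) := by
  have h1 := (hasFDerivAt_half_inner T hT x).smul hA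
  have h2 := ((hasGradientAt_iff_hasFDerivAt.1 hw).sub_const c).smul (T.hasFDerivAt (x := x))
  refine ⟨_, h1.sub h2, ?_⟩
  let b := stdOrthonormalBasis ℝ E
  rw [LinearMap.trace_eq_sum_inner _ b] at hT0 ⊢
  rw [LinearMap.trace_eq_sum_inner _ b]
  have h3 := b.sum_inner_mul_inner (T x) (G x)
  have h4 := b.sum_inner_mul_inner (G x) (T x)
  rw [real_inner_comm] at h4
  simp only [ContinuousLinearMap.coe_coe] at hT0 ⊢
  simp only [sub_apply, add_apply, smul_apply, ContinuousLinearMap.smulRight_apply, inner_sub_right,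
    inner_add_right, inner_smul_right, innerSL_apply_apply, InnerProductSpace.toDual_apply_apply,
    Finset.sum_sub_distrib, Finset.sum_add_distrib, ← Finset.mul_sum, hT0, h3, h4]
  ring

end Core

section Core

variable {E : Type*} [NormedAddCommGroup E] [InnerProductSpace ℝ E] [FiniteDimensional ℝ E]

theorem exists_lipschitzOnWith_field (T : E →L[ℝ] E) (hT : (T : E →ₗ[ℝ] E).IsSymmetric)
    {w : E → ℝ} {G : E → E} {L : NNReal} (c : ℝ)
    (hw : ∀ x ∈ ball (0 : E) 1, HasGradientAt w (G x) x) (hG : LipschitzOnWith L G (ball 0 1)) :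
    ∃ K, LipschitzOnWith K
      (fun x => ((1 / 2 : ℝ) * inner ℝ x (T x)) • G x - (w x - c) • T x) (ball (0 : E) 1) := by
  have h0 : (0 : E) ∈ ball (0 : E) 1 := by simp
  have hGb : ∀ x ∈ ball (0 : E) 1, ‖G x‖ ≤ (L + ‖G 0‖₊ : NNReal) := fun x hx => by
    have h1 := hG.dist_le_mul x hx 0 h0
    rw [dist_eq_norm, dist_zero_right] at h1
    have h2 : ‖x‖ < 1 := by simpa using hx
    have h3 : (L : ℝ) * ‖x‖ ≤ L := mul_le_of_le_one_right L.2 h2.le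
    have h4 : ‖G x‖ ≤ ‖G x - G 0‖ + ‖G 0‖ := norm_le_norm_sub_add _ _
    push_cast
    linarith
  have hTb : ∀ x ∈ ball (0 : E) 1, ‖T x‖ ≤ ‖T‖₊ := fun x hx => by
    have h2 : ‖x‖ < 1 := by simpa using hx
    exact (T.le_opNorm x).trans (mul_le_of_le_one_right (norm_nonneg _) h2.le)
  have hψ : LipschitzOnWith ‖T‖₊ (fun x => (1 / 2 : ℝ) * inner ℝ x (T x)) (ball (0 : E) 1) :=
    lipschitzOnWith_of_hasGradientAt (g := fun x => T x) (convex_ball 0 1)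
      (fun x _ => hasGradientAt_iff_hasFDerivAt.2 (hasFDerivAt_half_inner T hT x)) hTb
  have hψb : ∀ x ∈ ball (0 : E) 1, ‖(1 / 2 : ℝ) * inner ℝ x (T x)‖ ≤ ‖T‖₊ := fun x hx => by
    have h1 := hψ.dist_le_mul x hx 0 h0
    have h2 : ‖x‖ < 1 := by simpa using hx
    simp only [inner_zero_left, mul_zero, dist_zero_right] at h1
    exact h1.trans (mul_le_of_le_one_right (norm_nonneg _) h2.le)
  have hwL := lipschitzOnWith_of_hasGradientAt (convex_ball 0 1) hw hGb
  have hwL' : LipschitzOnWith (L + ‖G 0‖₊) (fun x => w x - c) (ball (0 : E) 1) := by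
    intro x hx y hy
    simpa [edist_dist, dist_eq_norm] using hwL hx hy
  have hwb : ∀ x ∈ ball (0 : E) 1, ‖w x - c‖ ≤ (L + ‖G 0‖₊ + ‖w 0 - c‖₊ : NNReal) := fun x hx => by
    have h1 := hwL.dist_le_mul x hx 0 h0
    rw [dist_eq_norm, dist_zero_right] at h1
    have h2 : ‖x‖ < 1 := by simpa using hx
    have h3 : ((L + ‖G 0‖₊ : NNReal) : ℝ) * ‖x‖ ≤ (L + ‖G 0‖₊ : NNReal) :=
      mul_le_of_le_one_right (NNReal.coe_nonneg _) h2.le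
    have h4 : ‖w x - c‖ ≤ ‖w x - w 0‖ + ‖w 0 - c‖ := norm_sub_le_norm_sub_add_norm_sub _ _ _
    push_cast at *
    linarith
  exact ⟨_, (hψ.smul_of_norm_le hG hψb hGb).sub
    (hwL'.smul_of_norm_le T.lipschitz.lipschitzOnWith hwb hTb)⟩

/-- Fundamental theorem of calculus for `r ↦ r⁻² (w(rω) - c)`. -/
theorem integral_ray_eq {w : E → ℝ} {G : E → E} (c : ℝ)
    (hw : ∀ x ∈ ball (0 : E) 1, HasGradientAt w (G x) x) (hG : ContinuousOn G (ball 0 1))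
    {a b : ℝ} (ha : 0 < a) (hab : a ≤ b) (hb : b < 1) {ω : E} (hω : ‖ω‖ = 1) :
    ∫ r in a..b, (r ^ 3)⁻¹ * (inner ℝ (G (r • ω)) (r • ω) - 2 * (w (r • ω) - c)) =
      (b ^ 2)⁻¹ * (w (b • ω) - c) - (a ^ 2)⁻¹ * (w (a • ω) - c) := by
  have hmem : ∀ r ∈ Set.uIcc a b, 0 < r ∧ r • ω ∈ ball (0 : E) 1 := fun r hr => by
    rw [Set.uIcc_of_le hab] at hr
    have : 0 < r := ha.trans_le hr.1
    refine ⟨this, ?_⟩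
    rw [mem_ball_zero_iff, norm_smul, hω, mul_one, Real.norm_of_nonneg this.le]
    exact hr.2.trans_lt hb
  refine intervalIntegral.integral_eq_sub_of_hasDerivAt
    (f := fun r => (r ^ 2)⁻¹ * (w (r • ω) - c)) (fun r hr => ?_) ?_
  · obtain ⟨hr0, hr1⟩ := hmem r hr
    have h1 := (hasDerivAt_pow 2 r).inv (pow_ne_zero 2 hr0.ne')
    have h2 : HasDerivAt (fun r : ℝ => r • ω) ω r := by
      simpa using (hasDerivAt_id r).smul_const ω
    have h3 := (hasGradientAt_iff_hasFDerivAt.1 (hw _ hr1)).comp_hasDerivAt r h2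
    refine (h1.mul (h3.sub_const c)).congr_deriv ?_
    simp only [InnerProductSpace.toDual_apply_apply, inner_smul_right, Function.comp,
      Pi.inv_apply]
    field_simp
    ring
  · have hwc : ContinuousOn w (ball 0 1) := fun x hx => (hw x hx).continuousAt.continuousWithinAt
    have hr : ContinuousOn (fun r : ℝ => r • ω) (Set.uIcc a b) := by fun_prop
    have hm : Set.MapsTo (fun r : ℝ => r • ω) (Set.uIcc a b) (ball 0 1) := fun r hr => (hmem r hr).2
    refine ContinuousOn.intervalIntegrable ?_
    refine ContinuousOn.mul (ContinuousOn.inv₀ (by fun_prop) fun r hr =>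
      pow_ne_zero 3 (hmem r hr).1.ne') ?_
    exact ((hG.comp hr hm).inner hr).sub (((hwc.comp hr hm).sub continuousOn_const).const_mul 2)

variable [MeasurableSpace E] [BorelSpace E]

/-- Green's identity on the annulus `a < |x| < b` for `w` against a harmonic quadratic form. -/
theorem integral_sphere_mul_sub_eq [Nontrivial E] (T : E →L[ℝ] E)
    (hT : (T : E →ₗ[ℝ] E).IsSymmetric)
    (hT0 : LinearMap.trace ℝ E (T : E →ₗ[ℝ] E) = 0) {w δ : E → ℝ} {G : E → E} {L : NNReal} (c : ℝ)
    (hw : ∀ x ∈ ball (0 : E) 1, HasGradientAt w (G x) x) (hG : LipschitzOnWith L G (ball 0 1))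
    (hδ : ∀ᵐ x ∂(volume.restrict (ball (0 : E) 1)), ∃ A : E →L[ℝ] E, HasFDerivAt G A x ∧
      LinearMap.trace ℝ E (A : E →ₗ[ℝ] E) = - δ x)
    {a b : ℝ} (ha : 0 < a) (hab : a ≤ b) (hb : b < 1) :
    ∫ ω, (1 / 2 * inner ℝ (ω : E) (T ω)) *
      ((a ^ 2)⁻¹ * (w (a • (ω : E)) - c) - (b ^ 2)⁻¹ * (w (b • (ω : E)) - c))
        ∂(volume : Measure E).toSphere =
    ∫ x in ball (0 : E) 1, δ x * (1 / 2 * inner ℝ x (T x)) *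
      radialCutoff (Module.finrank ℝ E + 2) a b ‖x‖ := by
  set n := Module.finrank ℝ E with hn
  have hn0 : n ≠ 0 := Module.finrank_pos.ne'
  set X : E → E := fun x => ((1 / 2 : ℝ) * inner ℝ x (T x)) • G x - (w x - c) • T x with hX
  set dg : E → E := {x : E | a < ‖x‖ ∧ ‖x‖ < b}.indicator (fun x => -(‖x‖ ^ (n + 2 + 2))⁻¹ • x)
    with hdg
  set W : E → ℝ := fun x => inner ℝ (G x) x - 2 * (w x - c) with hW
  obtain ⟨K, hK⟩ := exists_lipschitzOnWith_field T hT c hw hG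
  obtain ⟨D, hD⟩ := radialCutoff_lipschitzWith (m := n + 2) (by omega) b ha
  have hg0 : ∀ x : E, x ∉ closedBall (0 : E) b → radialCutoff (n + 2) a b ‖x‖ = 0 := fun x hx =>
    radialCutoff_of_le hab ((not_le.1 fun h => hx (by simpa using h)).le)
  have hgb : ∀ x : E, x ∉ ball (0 : E) 1 → x ∉ closedBall (0 : E) b := fun x hx hx' =>
    hx (closedBall_subset_ball hb hx')
  have key := setIntegral_ball_div_mul_eq (g := fun x => radialCutoff (n + 2) a b ‖x‖)
    (dg := dg) (divX := fun x => -(δ x * (1 / 2 * inner ℝ x (T x)))) hK (hD.comp lipschitzWith_one_norm)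
    (HasCompactSupport.intro (isCompact_closedBall 0 b) hg0) (fun x hx => hg0 x (hgb x hx))
    (fun x hx => Set.indicator_of_notMem (fun h => hgb x hx (by simpa using h.2.le)) _)
    (by
      have h1 : ∀ᵐ x : E, x ∉ sphere (0 : E) a :=
        measure_eq_zero_iff_ae_notMem.1 (Measure.addHaar_sphere volume 0 a)
      have h2 : ∀ᵐ x : E, x ∉ sphere (0 : E) b :=
        measure_eq_zero_iff_ae_notMem.1 (Measure.addHaar_sphere volume 0 b)
      filter_upwards [h1, h2] with x hx1 hx2
      exact hasGradientAt_radialCutoff (by omega) ha hab (by simpa using hx1) (by simpa using hx2))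
    (by
      filter_upwards [hδ, ae_restrict_mem measurableSet_ball] with x ⟨A, hA, hA'⟩ hx
      obtain ⟨A', h1, h2⟩ := exists_hasFDerivAt_trace_eq T hT hT0 c (hw x hx) hA
      exact ⟨A', h1, by rw [h2, hA']; ring⟩)
  have hwc : ContinuousOn w (ball 0 1) := fun x hx => (hw x hx).continuousAt.continuousWithinAt
  have hWc : ContinuousOn W (ball 0 1) :=
    (hG.continuousOn.inner continuousOn_id).sub ((hwc.sub continuousOn_const).const_mul 2)
  set S : Set E := {x : E | a < ‖x‖ ∧ ‖x‖ < b} with hS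
  have hSm : MeasurableSet S := ((isOpen_lt continuous_const continuous_norm).inter
    (isOpen_lt continuous_norm continuous_const)).measurableSet
  set f : E → ℝ := S.indicator fun x =>
    (‖x‖ ^ (n + 4))⁻¹ * ((1 / 2 * inner ℝ x (T x)) * W x) with hf
  have hfi : Integrable f := by
    rw [hf, integrable_indicator_iff hSm]
    have hcl : IsClosed {x : E | a ≤ ‖x‖} := isClosed_le continuous_const continuous_norm
    have hc : IsCompact (closedBall (0 : E) b ∩ {x : E | a ≤ ‖x‖}) :=
      (isCompact_closedBall 0 b).inter_right hcl
    refine IntegrableOn.mono_set (ContinuousOn.integrableOn_compact hc ?_)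
      (fun x hx => ⟨by simpa using hx.2.le, hx.1.le⟩)
    refine ContinuousOn.mul (ContinuousOn.inv₀ (by fun_prop) fun x hx =>
      pow_ne_zero _ (ha.trans_le hx.2).ne') (ContinuousOn.mul (by fun_prop) ?_)
    exact hWc.mono fun x hx => closedBall_subset_ball hb hx.1
  have h5 : - ∫ x in ball (0 : E) 1, inner ℝ (X x) (dg x) = ∫ x, f x := by
    rw [← integral_neg, ← setIntegral_eq_integral_of_forall_compl_eq_zero (s := ball (0 : E) 1)
      (f := f)]
    · refine integral_congr_ae (Eventually.of_forall fun x => ?_)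
      by_cases hx : x ∈ S
      · simp only [hdg, hf, hX, hW, Set.indicator_of_mem hx, inner_sub_left, inner_smul_left,
          inner_smul_right, real_inner_comm x (T x), RCLike.conj_to_real]
        ring
      · simp [hdg, hf, Set.indicator_of_notMem hx]
    · exact fun x hx => Set.indicator_of_notMem (fun h => hgb x hx (by simpa using h.2.le)) _
  rw [h5, integral_eq_integral_toSphere volume hfi] at key
  simp only [neg_mul, integral_neg] at key
  rw [← neg_eq_iff_eq_neg.2 key.symm, ← integral_neg]
  refine integral_congr_ae (Eventually.of_forall fun ω => ?_)
  have hω : ‖(ω : E)‖ = 1 := by simp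
  have h6 : ∀ r ∈ Set.Ioi (0 : ℝ), r ^ (n - 1) * f (r • (ω : E)) =
      (Set.Ioo a b).indicator (fun r => (1 / 2 * inner ℝ (ω : E) (T ω)) *
        ((r ^ 3)⁻¹ * (inner ℝ (G (r • (ω : E))) (r • (ω : E)) - 2 * (w (r • (ω : E)) - c)))) r := by
    intro r hr
    have hr0 : (0 : ℝ) < r := hr
    have hnr : ‖r • (ω : E)‖ = r := by rw [norm_smul, hω, mul_one, Real.norm_of_nonneg hr0.le]
    by_cases hrab : r ∈ Set.Ioo a b
    · have : r • (ω : E) ∈ S := by simpa [hS, hnr] using hrab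
      rw [Set.indicator_of_mem hrab, hf, Set.indicator_of_mem this, hnr]
      simp only [hW, map_smul, inner_smul_left, inner_smul_right, RCLike.conj_to_real]
      have : r ^ (n + 4) = r ^ (n - 1) * r ^ 5 := by rw [← pow_add]; congr 1; omega
      rw [this]
      field_simp
    · have : r • (ω : E) ∉ S := by simpa [hS, hnr] using hrab
      rw [Set.indicator_of_notMem hrab, hf, Set.indicator_of_notMem this, mul_zero]
  change _ = -∫ r in Set.Ioi (0 : ℝ), r ^ (n - 1) * f (r • (ω : E))
  have h7 := integral_ray_eq c hw hG.continuousOn ha hab hb hω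
  rw [setIntegral_congr_fun measurableSet_Ioi h6, setIntegral_indicator measurableSet_Ioo,
    Set.inter_eq_right.2 (show Set.Ioo a b ⊆ Set.Ioi 0 from fun r hr => ha.trans hr.1), integral_const_mul,
    ← integral_Ioc_eq_integral_Ioo, ← intervalIntegral.integral_of_le hab, h7]
  ring

end Core

theorem setIntegral_exp_mul_eq_radialCutoff {m : ℕ} (hm : m ≠ 0) {t s : ℝ} (hts : t ≤ s) (ρ : ℝ) :
    ∫ τ in Set.Ioo t s, {τ | ρ < Real.exp (-τ)}.indicator (fun τ => Real.exp (m * τ)) τ =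
      radialCutoff m (Real.exp (-s)) (Real.exp (-t)) ρ := by
  set M := max (Real.exp (-s)) (min (Real.exp (-t)) ρ) with hM
  have hM0 : 0 < M := lt_max_of_lt_left (Real.exp_pos _)
  have hMt : M ≤ Real.exp (-t) := max_le (by gcongr) (min_le_left _ _)
  obtain ⟨T, hT⟩ : ∃ T, M = Real.exp (-T) := ⟨-Real.log M, by rw [neg_neg, Real.exp_log hM0]⟩
  have htT : t ≤ T := by simpa [hT] using hMt
  have hTs : T ≤ s := by
    have : Real.exp (-s) ≤ M := le_max_left _ _
    simpa [hT] using this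
  have hm' : (m : ℝ) ≠ 0 := by exact_mod_cast hm
  have hset : Set.Ioo t s ∩ {τ | ρ < Real.exp (-τ)} = Set.Ioo t T := by
    ext τ
    have key : M < Real.exp (-τ) ↔ τ < T := by rw [hT]; simp
    rw [Set.mem_Ioo, ← key, hM]
    simp only [Set.mem_inter_iff, Set.mem_Ioo, Set.mem_ofPred_eq, max_lt_iff, min_lt_iff,
      Real.exp_lt_exp, neg_lt_neg_iff]
    constructor
    · rintro ⟨⟨h1, h2⟩, h3⟩
      exact ⟨h1, h2, Or.inr h3⟩
    · rintro ⟨h1, h2, h3⟩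
      exact ⟨⟨h1, h2⟩, h3.resolve_left h1.not_gt⟩
  have hderiv : ∀ τ ∈ Set.uIcc t T,
      HasDerivAt (fun τ : ℝ => Real.exp (m * τ) / m) (Real.exp (m * τ)) τ := fun τ _ => by
    refine ((((hasDerivAt_id τ).const_mul (m : ℝ)).exp).div_const (m : ℝ)).congr_deriv ?_
    simp only [id, mul_one]
    field_simp
  have hpow : ∀ τ : ℝ, Real.exp (m * τ) = (Real.exp (-τ) ^ m)⁻¹ := fun τ => by
    rw [← Real.exp_nat_mul, ← Real.exp_neg]
    congr 1
    ring
  rw [setIntegral_indicator (measurableSet_lt measurable_const (by fun_prop)), hset,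
    ← integral_Ioc_eq_integral_Ioo, ← intervalIntegral.integral_of_le htT,
    intervalIntegral.integral_eq_sub_of_hasDerivAt hderiv
      (Continuous.intervalIntegrable (by fun_prop) _ _), radialCutoff, ← hM, hT, hpow, hpow]

theorem intervalIntegral_exp_mul_setIntegral_ball {E : Type*} [NormedAddCommGroup E]
    [MeasurableSpace E] [BorelSpace E] {μ : Measure E} [SFinite μ] {m : ℕ} (hm : m ≠ 0) {t s : ℝ}
    (hts : t ≤ s) {f : E → ℝ} (hf : Integrable f μ) :
    ∫ τ in t..s, Real.exp (m * τ) * ∫ x in ball (0 : E) (Real.exp (-τ)), f x ∂μ =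
      ∫ x, f x * radialCutoff m (Real.exp (-s)) (Real.exp (-t)) ‖x‖ ∂μ := by
  set H : ℝ → E → ℝ := fun τ x =>
    {τ | ‖x‖ < Real.exp (-τ)}.indicator (fun τ => Real.exp (m * τ)) τ * f x with hH
  have hint : Integrable (Function.uncurry H) ((volume.restrict (Set.Ioo t s)).prod μ) := by
    have h1 : Integrable (fun p : ℝ × E => f p.2) ((volume.restrict (Set.Ioo t s)).prod μ) :=
      hf.comp_snd _
    have hmeas : Measurable fun p : ℝ × E =>
        {p : ℝ × E | ‖p.2‖ < Real.exp (-p.1)}.indicator (fun p => Real.exp (m * p.1)) p :=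
      Measurable.indicator (by fun_prop) (measurableSet_lt (by fun_prop) (by fun_prop))
    refine h1.bdd_mul (c := Real.exp (m * s)) hmeas.aestronglyMeasurable ?_
    have hmem : ∀ᵐ p ∂((volume.restrict (Set.Ioo t s)).prod μ), p.1 ∈ Set.Ioo t s :=
      Measure.quasiMeasurePreserving_fst.ae (ae_restrict_mem measurableSet_Ioo)
    filter_upwards [hmem] with p hp
    refine (norm_indicator_le_norm_self _ _).trans ?_
    rw [Real.norm_of_nonneg (Real.exp_pos _).le]
    have := hp.2.le
    gcongr
  rw [intervalIntegral.integral_of_le hts, integral_Ioc_eq_integral_Ioo]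
  calc _ = ∫ τ in Set.Ioo t s, ∫ x, H τ x ∂μ := by
        refine integral_congr_ae (Eventually.of_forall fun τ => ?_)
        simp only
        rw [← integral_const_mul, ← integral_indicator measurableSet_ball]
        refine integral_congr_ae (Eventually.of_forall fun x => ?_)
        by_cases hx : ‖x‖ < Real.exp (-τ)
        · simp [hH, Set.indicator, hx]
        · simp [hH, Set.indicator, hx]
    _ = ∫ x, (∫ τ in Set.Ioo t s, H τ x) ∂μ := integral_integral_swap hint
    _ = _ := by
        refine integral_congr_ae (Eventually.of_forall fun x => ?_)
        simp only [hH]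
        rw [integral_mul_const, setIntegral_exp_mul_eq_radialCutoff hm hts, mul_comm]

/-- The entrywise `ℓ¹` norm of a matrix. -/
def entrySum {n : ℕ} (D : Matrix (Fin n) (Fin n) ℝ) : ℝ := ∑ i, ∑ j, |D i j|

theorem entrySum_nonneg {n : ℕ} (D : Matrix (Fin n) (Fin n) ℝ) : 0 ≤ entrySum D :=
  Finset.sum_nonneg fun _ _ => Finset.sum_nonneg fun _ _ => abs_nonneg _

theorem abs_le_entrySum {n : ℕ} (D : Matrix (Fin n) (Fin n) ℝ) (i j : Fin n) :
    |D i j| ≤ entrySum D :=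
  (Finset.single_le_sum (f := fun j => |D i j|) (fun _ _ => abs_nonneg _) (Finset.mem_univ j)).trans
    (Finset.single_le_sum (f := fun i => ∑ j, |D i j|)
      (fun _ _ => Finset.sum_nonneg fun _ _ => abs_nonneg _) (Finset.mem_univ i))

theorem entrySum_smul {n : ℕ} (c : ℝ) (D : Matrix (Fin n) (Fin n) ℝ) :
    entrySum (c • D) = |c| * entrySum D := by
  simp [entrySum, abs_mul, Finset.mul_sum]

theorem abs_sum_sum_mul_mul_le {n : ℕ} (D : Matrix (Fin n) (Fin n) ℝ) (x : En n) :
    |∑ i, ∑ j, D i j * x i * x j| ≤ entrySum D * ‖x‖ ^ 2 := by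
  rw [entrySum, Finset.sum_mul]
  refine (Finset.abs_sum_le_sum_abs _ _).trans (Finset.sum_le_sum fun i _ => ?_)
  rw [Finset.sum_mul]
  refine (Finset.abs_sum_le_sum_abs _ _).trans (Finset.sum_le_sum fun j _ => ?_)
  have hi : |x i| ≤ ‖x‖ := PiLp.norm_apply_le x i
  have hj : |x j| ≤ ‖x‖ := PiLp.norm_apply_le x j
  rw [abs_mul, abs_mul, mul_assoc, sq]
  gcongr

theorem psiM_smul_left {n : ℕ} (c : ℝ) (D : Matrix (Fin n) (Fin n) ℝ) (x : En n) :
    psiM (c • D) x = c * psiM D x := by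
  simp only [psiM, Matrix.smul_apply, smul_eq_mul, Finset.mul_sum]
  refine Finset.sum_congr rfl fun i _ => Finset.sum_congr rfl fun j _ => ?_
  ring

theorem psiM_sub {n : ℕ} (C D : Matrix (Fin n) (Fin n) ℝ) (x : En n) :
    psiM (C - D) x = psiM C x - psiM D x := by
  simp only [psiM, Matrix.sub_apply, sub_mul, Finset.sum_sub_distrib, mul_sub]

theorem psiM_smul {n : ℕ} (D : Matrix (Fin n) (Fin n) ℝ) (c : ℝ) (x : En n) :
    psiM D (c • x) = c ^ 2 * psiM D x := by
  simp only [psiM, PiLp.smul_apply, smul_eq_mul, Finset.mul_sum]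
  refine Finset.sum_congr rfl fun i _ => Finset.sum_congr rfl fun j _ => ?_
  ring

theorem continuous_psiM {n : ℕ} (D : Matrix (Fin n) (Fin n) ℝ) : Continuous (psiM D) := by
  unfold psiM
  fun_prop

theorem continuous_psiM_uncurry (n : ℕ) :
    Continuous fun p : Matrix (Fin n) (Fin n) ℝ × En n => psiM p.1 p.2 := by
  have h : ∀ i j, Continuous fun p : Matrix (Fin n) (Fin n) ℝ × En n => p.1 i j := fun i j =>
    continuous_fst.matrix_elem i j
  unfold psiM
  fun_prop

theorem eq_zero_of_psiM_eq_zero {n : ℕ} {D : Matrix (Fin n) (Fin n) ℝ} (hD : D.IsSymm)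
    (h : ∀ x ∈ sphere (0 : En n) 1, psiM D x = 0) : D = 0 := by
  have h' : ∀ x : En n, psiM D x = 0 := fun x => by
    rcases eq_or_ne x 0 with rfl | hx
    · simp [psiM]
    · have h1 : (‖x‖⁻¹ • x) ∈ sphere (0 : En n) 1 := by simp [norm_smul, hx]
      have h2 := h _ h1
      rw [psiM_smul] at h2
      exact (mul_eq_zero.1 h2).resolve_left (by simpa using hx)
  have hval : ∀ a b : Fin n, psiM D (EuclideanSpace.single a 1 + EuclideanSpace.single b 1) =
      (1 / 2) * (D a a + D a b + (D b a + D b b)) := fun a b => by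
    simp [psiM, mul_add, Finset.sum_add_distrib]
    ring
  ext a b
  have h1 := (hval a a).symm.trans (h' _)
  have h2 := (hval b b).symm.trans (h' _)
  have h3 := (hval a b).symm.trans (h' _)
  have h4 := hD.apply a b
  simp only [Matrix.zero_apply]
  linarith

theorem exists_pos_mul_entrySum_sq_le (n : ℕ) (hn : 2 ≤ n) : ∃ κ : ℝ, 0 < κ ∧
    ∀ D : Matrix (Fin n) (Fin n) ℝ, D.IsSymm →
      κ * entrySum D ^ 2 ≤ ∫ ω, psiM D (ω : En n) ^ 2 ∂(volume : Measure (En n)).toSphere := by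
  have : Nonempty (Fin n) := ⟨⟨0, by omega⟩⟩
  set Q : Matrix (Fin n) (Fin n) ℝ → ℝ := fun D =>
    ∫ ω, psiM D (ω : En n) ^ 2 ∂(volume : Measure (En n)).toSphere with hQ
  have hQ0 : ∀ D, 0 ≤ Q D := fun D => integral_nonneg fun ω => sq_nonneg _
  have hQc : Continuous Q := by
    have : FirstCountableTopology (Matrix (Fin n) (Fin n) ℝ) :=
      inferInstanceAs (FirstCountableTopology (Fin n → Fin n → ℝ))
    have : LocallyCompactSpace (Matrix (Fin n) (Fin n) ℝ) :=
      inferInstanceAs (LocallyCompactSpace (Fin n → Fin n → ℝ))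
    have h1 : Continuous fun p : Matrix (Fin n) (Fin n) ℝ × sphere (0 : En n) 1 =>
        psiM p.1 (p.2 : En n) ^ 2 :=
      ((continuous_psiM_uncurry n).comp
        (continuous_fst.prodMk (continuous_subtype_val.comp continuous_snd))).pow 2
    have h2 := continuous_parametric_integral_of_continuous
      (μ := (volume : Measure (En n)).toSphere)
      (f := fun (D : Matrix (Fin n) (Fin n) ℝ) (ω : sphere (0 : En n) 1) => psiM D (ω : En n) ^ 2)
      h1 isCompact_univ
    simpa using h2
  have hsm : ∀ c D, Q (c • D) = c ^ 2 * Q D := fun c D => by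
    simp only [hQ, psiM_smul_left, mul_pow, integral_const_mul]
  set K : Set (Matrix (Fin n) (Fin n) ℝ) := {D | D.IsSymm ∧ entrySum D = 1} with hK
  have hc : Continuous (entrySum : Matrix (Fin n) (Fin n) ℝ → ℝ) := by
    have h : ∀ i j, Continuous fun p : Matrix (Fin n) (Fin n) ℝ => p i j := fun i j =>
      continuous_id.matrix_elem i j
    unfold entrySum
    fun_prop
  have hKc : IsCompact K := by
    have hbox := isCompact_univ_pi (X := fun _ : Fin n => Fin n → ℝ) fun _ =>
      isCompact_univ_pi (X := fun _ : Fin n => ℝ) fun _ => isCompact_Icc (a := (-1 : ℝ)) (b := 1)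
    refine IsCompact.of_isClosed_subset (X := Matrix (Fin n) (Fin n) ℝ) hbox ?_
      fun D hD i _ j _ => ?_
    · exact (isClosed_eq (continuous_id.matrix_transpose) continuous_id).inter
        (isClosed_eq hc continuous_const)
    · exact abs_le.1 ((abs_le_entrySum D i j).trans_eq hD.2)
  have hpos : ∀ D ∈ K, 0 < Q D := fun D hD => by
    by_contra hcon
    have h0 : Q D = 0 := le_antisymm (not_lt.1 hcon) (hQ0 D)
    have hcont : Continuous fun ω : sphere (0 : En n) 1 => psiM D (ω : En n) ^ 2 :=
      ((continuous_psiM D).comp continuous_subtype_val).pow 2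
    have hint : Integrable (fun ω : sphere (0 : En n) 1 => psiM D (ω : En n) ^ 2)
        (volume : Measure (En n)).toSphere :=
      hcont.integrable_of_hasCompactSupport (HasCompactSupport.of_compactSpace _)
    have h1 := (integral_eq_zero_iff_of_nonneg (fun ω => sq_nonneg _) hint).1 h0
    have h2 := (hcont.ae_eq_iff_eq _ continuous_zero).1 h1
    have h3 : D = 0 := eq_zero_of_psiM_eq_zero hD.1 fun x hx => by
      simpa using congrFun h2 ⟨x, hx⟩
    have := hD.2
    simp [h3, entrySum] at this
  have hnorm : ∀ D : Matrix (Fin n) (Fin n) ℝ, D.IsSymm → entrySum D ≠ 0 →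
      (entrySum D)⁻¹ • D ∈ K := fun D hD h0 => by
    refine ⟨?_, ?_⟩
    · rw [Matrix.IsSymm, Matrix.transpose_smul, hD]
    · rw [entrySum_smul, abs_of_nonneg (inv_nonneg.2 (entrySum_nonneg D)), inv_mul_cancel₀ h0]
  obtain ⟨κ, hκ, hκK⟩ : ∃ κ : ℝ, 0 < κ ∧ ∀ D ∈ K, κ ≤ Q D := by
    rcases K.eq_empty_or_nonempty with hE | hE
    · exact ⟨1, one_pos, fun D hD => by simp [hE] at hD⟩
    · obtain ⟨D, hD, hmin⟩ := hKc.exists_isMinOn hE hQc.continuousOn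
      exact ⟨Q D, hpos D hD, fun D' hD' => hmin hD'⟩
  refine ⟨κ, hκ, fun D hD => ?_⟩
  rcases eq_or_ne (entrySum D) 0 with h0 | h0
  · rw [h0]
    simpa using hQ0 D
  · have h1 := hκK _ (hnorm D hD h0)
    rw [hsm, inv_pow] at h1
    have h2 : 0 < entrySum D ^ 2 := by positivity
    calc κ * entrySum D ^ 2 ≤ (entrySum D ^ 2)⁻¹ * Q D * entrySum D ^ 2 := by gcongr
      _ = Q D := by field_simp

theorem psiM_eq_inner {n : ℕ} (D : Matrix (Fin n) (Fin n) ℝ) (x : En n) :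
    psiM D x = 1 / 2 * inner ℝ x (Matrix.toEuclideanLin D x) := by
  rw [psiM, EuclideanSpace.inner_eq_star_dotProduct]
  simp only [dotProduct, Matrix.ofLp_toLpLin, Matrix.toLin'_apply, Matrix.mulVec, Pi.star_apply,
    star_trivial, Finset.sum_mul]
  congr 1
  refine Finset.sum_congr rfl fun i _ => Finset.sum_congr rfl fun j _ => ?_
  ring

theorem hasGradientAt_psiM {n : ℕ} {D : Matrix (Fin n) (Fin n) ℝ} (hD : D.IsSymm) (x : En n) :
    HasGradientAt (psiM D) (Matrix.toEuclideanLin D x) x := by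
  have hsymm : (Matrix.toEuclideanLin D).IsSymmetric := by
    rw [Matrix.isSymmetric_toEuclideanLin_iff, Matrix.isHermitian_iff_isSymm]
    exact hD
  rw [hasGradientAt_iff_hasFDerivAt]
  refine (hasFDerivAt_half_inner (LinearMap.toContinuousLinearMap (Matrix.toEuclideanLin D))
    hsymm x).congr_of_eventuallyEq (Eventually.of_forall fun y => psiM_eq_inner D y)

theorem hasGradientAt_p0 (n : ℕ) (x : En n) : HasGradientAt (p0 n) ((n : ℝ)⁻¹ • x) x := by
  rw [hasGradientAt_iff_hasFDerivAt]
  have h := (hasStrictFDerivAt_norm_sq x).hasFDerivAt.mul_const ((2 * n : ℝ)⁻¹)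
  refine (h.congr_of_eventuallyEq (Eventually.of_forall fun y => div_eq_mul_inv _ _)).congr_fderiv ?_
  ext v
  simp
  ring

theorem p0_smul (n : ℕ) (c : ℝ) (x : En n) : p0 n (c • x) = c ^ 2 * p0 n x := by
  simp [p0, norm_smul, mul_pow, mul_div_assoc]

section Solution

variable {n : ℕ} {u : En n → ℝ}

theorem SolutionHyp.hasGradientAt (hu : SolutionHyp u) {x : En n} (hx : x ∈ ball (0 : En n) 1) :
    HasGradientAt u (gradient u x) x :=
  (hu.1 x hx).hasGradientAt

theorem SolutionHyp.continuousOn (hu : SolutionHyp u) : ContinuousOn u (ball 0 1) := fun x hx =>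
  (hu.1 x hx).continuousAt.continuousWithinAt

theorem SolutionHyp.measurableSet_Lam (hu : SolutionHyp u) : MeasurableSet (Lam u) := by
  obtain ⟨L, hL⟩ := hu.2.1
  have h1 := hL.continuousOn.isOpen_inter_preimage isOpen_ball (isOpen_compl_singleton (x := 0))
  have h2 : Lam u = ball (0 : En n) 1 \
      (ball (0 : En n) 1 ∩ (fun x => gradient u x) ⁻¹' {0}ᶜ) := by
    ext x
    simp only [Lam, Set.mem_sdiff, Set.mem_inter_iff, Set.mem_preimage, Set.mem_compl_iff,
      Set.mem_singleton_iff, Set.mem_ofPred_eq]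
    tauto
  rw [h2]
  exact measurableSet_ball.diff h1.measurableSet

theorem SolutionHyp.measurableSet_LamT (hu : SolutionHyp u) (t : ℝ) : MeasurableSet (LamT u t) :=
  hu.measurableSet_Lam.const_smul₀ _

theorem continuousOn_ut (hu : SolutionHyp u) {t : ℝ} (ht : 0 < t) :
    ContinuousOn (ut u t) (sphere 0 1) := by
  have hm : Set.MapsTo (fun x : En n => Real.exp (-t) • x) (sphere 0 1) (ball 0 1) := fun x hx => by
    have : ‖x‖ = 1 := by simpa using hx
    simp [norm_smul, this, ht]
  exact ((hu.continuousOn.comp (by fun_prop) hm).sub continuousOn_const).const_mul _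

/-- Change of variables for `2`-homogeneous integrands. -/
theorem setIntegral_smul_of_homogeneous {f : En n → ℝ} {R : ℝ} (hR : 0 < R)
    (hf : ∀ x, f (R • x) = R ^ 2 * f x) (s : Set (En n)) :
    ∫ x in R • s, f x = R ^ (n + 2) * ∫ x in s, f x := by
  have h := Measure.setIntegral_comp_smul_of_pos volume f s hR
  simp only [hf, integral_const_mul, finrank_euclideanSpace_fin, smul_eq_mul] at h
  rw [pow_add, mul_assoc, h]
  field_simp

theorem Fdef_eq (u : En n → ℝ) (τ : ℝ) :
    Fdef u τ = Real.exp ((n + 2 : ℕ) * τ) *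
      ∫ x in ball (0 : En n) (Real.exp (-τ)) ∩ Lam u, ‖x‖ ^ 2 := by
  have h1 : LamT u τ ∩ ball (0 : En n) 1 =
      Real.exp τ • (ball (0 : En n) (Real.exp (-τ)) ∩ Lam u) := by
    rw [Set.smul_set_inter₀ (Real.exp_pos τ).ne', _root_.smul_ball (Real.exp_pos τ).ne', smul_zero,
      Real.norm_of_nonneg (Real.exp_pos τ).le, ← Real.exp_add, add_neg_cancel, Real.exp_zero,
      Set.inter_comm, LamT]
  rw [Fdef, h1, setIntegral_smul_of_homogeneous (Real.exp_pos τ)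
    (fun x => by simp [norm_smul, mul_pow]), ← Real.exp_nat_mul]

theorem integrableOn_of_continuous_of_subset_ball {f : En n → ℝ} (hf : Continuous f)
    {s : Set (En n)} (hs : s ⊆ ball 0 1) : IntegrableOn f s :=
  (hf.continuousOn.integrableOn_compact (isCompact_closedBall (0 : En n) 1)).mono_set
    (hs.trans ball_subset_closedBall)

theorem intervalIntegral_Fdef_eq (u : En n → ℝ) {t s : ℝ} (hts : t ≤ s) :
    ∫ τ in t..s, Fdef u τ = ∫ x in Lam u, ‖x‖ ^ 2 *
      radialCutoff (n + 2) (Real.exp (-s)) (Real.exp (-t)) ‖x‖ := by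
  have hint : IntegrableOn (fun x : En n => ‖x‖ ^ 2) (Lam u) :=
    integrableOn_of_continuous_of_subset_ball (by fun_prop) fun x hx => hx.1
  rw [← intervalIntegral_exp_mul_setIntegral_ball (by omega) hts hint]
  refine intervalIntegral.integral_congr fun τ _ => ?_
  simp only [Fdef_eq, Measure.restrict_restrict measurableSet_ball]

/-- The evolution of the second order coefficient of `u` between two scales. -/
theorem integral_psiM_mul_ut_sub_eq (hn : 2 ≤ n) (hu : SolutionHyp u)
    {D : Matrix (Fin n) (Fin n) ℝ} (hD : S0 D) {t s : ℝ} (ht : 0 < t) (hts : t ≤ s) :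
    ∫ ω, psiM D (ω : En n) * ((ut u s ω - p0 n ω) - (ut u t ω - p0 n ω))
      ∂(volume : Measure (En n)).toSphere =
    ∫ x in Lam u, psiM D x * radialCutoff (n + 2) (Real.exp (-s)) (Real.exp (-t)) ‖x‖ := by
  have : Nonempty (Fin n) := ⟨⟨0, by omega⟩⟩
  have hn0 : (n : ℝ) ≠ 0 := by positivity
  set T := LinearMap.toContinuousLinearMap (Matrix.toEuclideanLin D) with hTdef
  have hT : (T : En n →ₗ[ℝ] En n).IsSymmetric := by
    rw [hTdef, LinearMap.coe_toContinuousLinearMap, Matrix.isSymmetric_toEuclideanLin_iff,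
      Matrix.isHermitian_iff_isSymm]
    exact hD.1
  have hT0 : LinearMap.trace ℝ (En n) (T : En n →ₗ[ℝ] En n) = 0 := by
    rw [hTdef, LinearMap.coe_toContinuousLinearMap]
    change LinearMap.trace ℝ (En n) (Matrix.toLpLin 2 2 D) = 0
    rw [Matrix.toLpLin_eq_toLin, Matrix.trace_toLin_eq, hD.2]
  have hψ : ∀ x, 1 / 2 * inner ℝ x (T x) = psiM D x := fun x => (psiM_eq_inner D x).symm
  obtain ⟨L, hL⟩ := hu.2.1
  set w : En n → ℝ := fun x => u x - p0 n x with hw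
  set G : En n → En n := fun x => gradient u x - (n : ℝ)⁻¹ • x with hG
  have hwG : ∀ x ∈ ball (0 : En n) 1, HasGradientAt w (G x) x := fun x hx => by
    have h1 := (hasGradientAt_iff_hasFDerivAt.1 (hu.hasGradientAt hx)).sub
      (hasGradientAt_iff_hasFDerivAt.1 (hasGradientAt_p0 n x))
    rw [hasGradientAt_iff_hasFDerivAt, hG, map_sub]
    exact h1
  have hGL : LipschitzOnWith (L + ‖(n : ℝ)⁻¹‖₊) G (ball 0 1) :=
    hL.sub (lipschitzWith_smul ((n : ℝ)⁻¹)).lipschitzOnWith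
  have hδ : ∀ᵐ x ∂(volume.restrict (ball (0 : En n) 1)), ∃ A : En n →L[ℝ] En n,
      HasFDerivAt G A x ∧ LinearMap.trace ℝ (En n) (A : En n →ₗ[ℝ] En n) =
        - (Lam u).indicator (fun _ => (1 : ℝ)) x := by
    filter_upwards [hu.2.2.1, ae_restrict_mem measurableSet_ball] with x ⟨A, hA, hA0, hA1⟩ hx
    refine ⟨A - (n : ℝ)⁻¹ • ContinuousLinearMap.id ℝ (En n),
      hA.sub ((hasFDerivAt_id x).const_smul ((n : ℝ)⁻¹)), ?_⟩
    have htr : LinearMap.trace ℝ (En n)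
        ((A - (n : ℝ)⁻¹ • ContinuousLinearMap.id ℝ (En n) : En n →L[ℝ] En n) :
          En n →ₗ[ℝ] En n) = LinearMap.trace ℝ (En n) (A : En n →ₗ[ℝ] En n) - 1 := by
      simp [hn0]
    rw [htr]
    by_cases hx0 : gradient u x = 0
    · rw [hA0 hx0, Set.indicator_of_mem (show x ∈ Lam u from ⟨hx, hx0⟩)]
      ring
    · rw [hA1 hx0, Set.indicator_of_notMem (fun h => hx0 h.2)]
      ring
  have key := integral_sphere_mul_sub_eq T hT hT0 (w 0) hwG hGL hδ (Real.exp_pos (-s))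
    (show Real.exp (-s) ≤ Real.exp (-t) by gcongr) (by simpa using ht)
  simp only [hψ, finrank_euclideanSpace_fin] at key
  have hv : ∀ τ : ℝ, ∀ x : En n, (Real.exp (-τ) ^ 2)⁻¹ * (w (Real.exp (-τ) • x) - w 0) =
      ut u τ x - p0 n x := fun τ x => by
    have h1 : Real.exp (2 * τ) = (Real.exp (-τ) ^ 2)⁻¹ := by
      rw [← Real.exp_nat_mul, ← Real.exp_neg]
      congr 1
      push_cast
      ring
    have h2 : Real.exp (-τ) ≠ 0 := (Real.exp_pos _).ne'
    have h3 : p0 n 0 = 0 := by simp [p0]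
    rw [ut, h1, hw]
    simp only [p0_smul, h3]
    field_simp
    ring
  simp only [hv] at key
  rw [key]
  have hind : ∀ x, (Lam u).indicator (fun _ => (1 : ℝ)) x * psiM D x *
      radialCutoff (n + 2) (Real.exp (-s)) (Real.exp (-t)) ‖x‖ =
      (Lam u).indicator (fun x => psiM D x *
        radialCutoff (n + 2) (Real.exp (-s)) (Real.exp (-t)) ‖x‖) x := fun x => by
    by_cases hx : x ∈ Lam u <;> simp [hx]
  simp only [hind]
  rw [setIntegral_indicator hu.measurableSet_Lam,
    Set.inter_eq_right.2 (show Lam u ⊆ ball 0 1 from fun x hx => hx.1)]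

theorem integral_psiM_mul_psiM_sub_eq (hn : 2 ≤ n) (hu : SolutionHyp u)
    {B : ℝ → Matrix (Fin n) (Fin n) ℝ} (hB : BProp u B) {D : Matrix (Fin n) (Fin n) ℝ} (hD : S0 D)
    {t s : ℝ} (ht : 0 < t) (hts : t ≤ s) :
    ∫ ω, psiM D (ω : En n) * psiM (B s - B t) ω ∂(volume : Measure (En n)).toSphere =
    ∫ x in Lam u, psiM D x * radialCutoff (n + 2) (Real.exp (-s)) (Real.exp (-t)) ‖x‖ := by
  obtain ⟨c, hc, hcf⟩ := exists_pos_integral_sphMeas_eq n hn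
  have hp0 : Continuous (p0 n) := by unfold p0; fun_prop
  have hcont : ∀ τ, 0 < τ → ContinuousOn
      (fun x => (ut u τ x - p0 n x - psiM (B τ) x) * psiM D x) (sphere 0 1) := fun τ hτ =>
    (((continuousOn_ut hu hτ).sub hp0.continuousOn).sub (continuous_psiM _).continuousOn).mul
      (continuous_psiM _).continuousOn
  have hint : ∀ f : En n → ℝ, ContinuousOn f (sphere 0 1) →
      Integrable (fun ω : sphere (0 : En n) 1 => f ω) (volume : Measure (En n)).toSphere :=
    fun f hf => (continuousOn_iff_continuous_domRestrict.1 hf).integrable_of_hasCompactSupport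
      (HasCompactSupport.of_compactSpace _)
  have hzero : ∀ τ, 0 < τ → ∫ ω, (ut u τ (ω : En n) - p0 n ω - psiM (B τ) ω) * psiM D ω
      ∂(volume : Measure (En n)).toSphere = 0 := fun τ hτ => by
    have h := (hB τ hτ).2 D hD
    rw [hcf _ (hcont τ hτ)] at h
    exact (mul_eq_zero.1 h).resolve_left hc.ne'
  have hs : 0 < s := ht.trans_le hts
  rw [← integral_psiM_mul_ut_sub_eq hn hu hD ht hts, ← sub_eq_zero]
  have hc1 : ContinuousOn (fun ω : En n => psiM D ω * psiM (B s - B t) ω) (sphere 0 1) :=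
    ((continuous_psiM _).mul (continuous_psiM _)).continuousOn
  have hc2 : ContinuousOn (fun ω : En n => psiM D ω *
      ((ut u s ω - p0 n ω) - (ut u t ω - p0 n ω))) (sphere 0 1) :=
    (continuous_psiM _).continuousOn.mul (((continuousOn_ut hu hs).sub hp0.continuousOn).sub
      ((continuousOn_ut hu ht).sub hp0.continuousOn))
  rw [← integral_sub (hint _ hc1) (hint _ hc2)]
  rw [← sub_eq_zero.2 ((hzero t ht).trans (hzero s hs).symm),
    ← integral_sub (hint _ (hcont t ht)) (hint _ (hcont s hs))]
  refine integral_congr_ae (Eventually.of_forall fun ω => ?_)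
  simp only [psiM_sub]
  ring

theorem S0.sub {C D : Matrix (Fin n) (Fin n) ℝ} (hC : S0 C) (hD : S0 D) : S0 (C - D) :=
  ⟨Matrix.IsSymm.sub hC.1 hD.1, by rw [Matrix.trace_sub, hC.2, hD.2, sub_zero]⟩

theorem intervalIntegral_Fdef_nonneg (u : En n → ℝ) {t s : ℝ} (hts : t ≤ s) :
    0 ≤ ∫ τ in t..s, Fdef u τ :=
  intervalIntegral.integral_nonneg hts fun _ _ => integral_nonneg fun _ => by positivity

theorem entrySum_sub_le (hn : 2 ≤ n) {κ : ℝ} (hκ : 0 < κ)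
    (hκD : ∀ D : Matrix (Fin n) (Fin n) ℝ, D.IsSymm →
      κ * entrySum D ^ 2 ≤ ∫ ω, psiM D (ω : En n) ^ 2 ∂(volume : Measure (En n)).toSphere)
    (hu : SolutionHyp u) {B : ℝ → Matrix (Fin n) (Fin n) ℝ} (hB : BProp u B)
    {t s : ℝ} (ht : 0 < t) (hts : t ≤ s) :
    entrySum (B s - B t) ≤ (2 * κ)⁻¹ * ∫ τ in t..s, Fdef u τ := by
  have hD : S0 (B s - B t) := (hB s (ht.trans_le hts)).1.sub (hB t ht).1
  set D := B s - B t with hDdef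
  have h1 := hκD D hD.1
  simp only [sq (psiM D _)] at h1
  rw [hDdef, integral_psiM_mul_psiM_sub_eq hn hu hB hD ht hts, ← hDdef] at h1
  have hηc : Continuous fun x : En n =>
      radialCutoff (n + 2) (Real.exp (-s)) (Real.exp (-t)) ‖x‖ :=
    (radialCutoff_lipschitzWith (by omega) _ (Real.exp_pos _)).choose_spec.continuous.comp
      continuous_norm
  have h2 : ∫ x in Lam u, psiM D x * radialCutoff (n + 2) (Real.exp (-s)) (Real.exp (-t)) ‖x‖ ≤
      ∫ x in Lam u, (entrySum D / 2) *
        (‖x‖ ^ 2 * radialCutoff (n + 2) (Real.exp (-s)) (Real.exp (-t)) ‖x‖) := by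
    refine integral_mono (integrableOn_of_continuous_of_subset_ball
      ((continuous_psiM D).mul hηc) fun x hx => hx.1)
      (integrableOn_of_continuous_of_subset_ball (by fun_prop) fun x hx => hx.1) fun x => ?_
    have h3 := (le_abs_self _).trans (abs_sum_sum_mul_mul_le D x)
    have h4 : psiM D x ≤ entrySum D / 2 * ‖x‖ ^ 2 := by
      rw [psiM]
      linarith
    simp only
    rw [← mul_assoc]
    exact mul_le_mul_of_nonneg_right h4
      (radialCutoff_nonneg (Real.exp_pos _) (by gcongr) _)
  rw [integral_const_mul, ← intervalIntegral_Fdef_eq u hts] at h2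
  have h5 := intervalIntegral_Fdef_nonneg u hts
  rcases (entrySum_nonneg D).eq_or_lt with h0 | h0
  · rw [← h0]
    positivity
  · rw [inv_mul_eq_div, le_div_iff₀ (by positivity)]
    nlinarith

theorem abs_setIntegral_quadratic_le (u : En n → ℝ) (s : ℝ) (D : Matrix (Fin n) (Fin n) ℝ) :
    |∫ z in LamT u s ∩ ann0 n, ∑ i, ∑ j, D i j * z i * z j| ≤ entrySum D * F0 u s := by
  have hint : IntegrableOn (fun x : En n => entrySum D * ‖x‖ ^ 2) (LamT u s ∩ ann0 n) :=
    integrableOn_of_continuous_of_subset_ball (by fun_prop) fun x hx => by simpa using hx.2.2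
  rw [F0, ← integral_const_mul]
  rw [← Real.norm_eq_abs]
  exact norm_integral_le_of_norm_le hint
    (Eventually.of_forall fun x => abs_sum_sum_mul_mul_le D x)

theorem sum_mul_gradient_Rt (hu : SolutionHyp u) {B : ℝ → Matrix (Fin n) (Fin n) ℝ}
    (hn : 2 ≤ n) {t : ℝ} (hB : (B t).IsSymm) {x : En n} (hx : x ∈ LamT u t) :
    ∑ i, x i * gradient (Rt u B t) x i = -(2 * qB (B t) x) := by
  have hx' : Real.exp (-t) • x ∈ Lam u := by
    rwa [LamT, Set.mem_smul_set_iff_inv_smul_mem₀ (Real.exp_pos t).ne', ← Real.exp_neg] at hx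
  have hut : HasFDerivAt (ut u t) (0 : En n →L[ℝ] ℝ) x := by
    have h1 := hasGradientAt_iff_hasFDerivAt.1 (hu.hasGradientAt hx'.1)
    rw [hx'.2, map_zero] at h1
    have h2 := ((h1.comp x ((hasFDerivAt_id x).const_smul (Real.exp (-t)))).sub_const
      (u 0)).const_mul (Real.exp (2 * t))
    exact h2.congr_fderiv (by simp)
  have hR : HasGradientAt (Rt u B t)
      (0 - ((n : ℝ)⁻¹ • x + Matrix.toEuclideanLin (B t) x)) x := by
    rw [hasGradientAt_iff_hasFDerivAt, map_sub, map_zero, map_add]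
    exact hut.sub ((hasGradientAt_iff_hasFDerivAt.1 (hasGradientAt_p0 n x)).add
      (hasGradientAt_iff_hasFDerivAt.1 (hasGradientAt_psiM hB x)))
  have hsum : ∀ v : En n, ∑ i, x i * v i = inner ℝ x v := fun v => by
    simp [EuclideanSpace.inner_eq_star_dotProduct, dotProduct, mul_comm]
  have hn0 : (n : ℝ) ≠ 0 := by positivity
  rw [hR.gradient, hsum, qB, psiM_eq_inner, p0, zero_sub, inner_neg_right, inner_add_right,
    inner_smul_right, real_inner_self_eq_norm_sq]
  field_simp

theorem LamT_inter_annK_eq (u : En n → ℝ) (t : ℝ) (k : ℕ) :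
    LamT u t ∩ annK n k = ((2 : ℝ) ^ k)⁻¹ • (LamT u (t + k * Real.log 2) ∩ ann0 n) := by
  have h2k : (0 : ℝ) < 2 ^ k := by positivity
  rw [Set.smul_set_inter₀ (inv_pos.2 h2k).ne']
  congr 1
  · rw [LamT, LamT, smul_smul, Real.exp_add, Real.exp_nat_mul, Real.exp_log two_pos]
    congr 1
    field_simp
  · ext x
    rw [Set.mem_smul_set_iff_inv_smul_mem₀ (inv_pos.2 h2k).ne', inv_inv]
    simp only [annK, ann0, Set.mem_ofPred_eq, norm_smul, norm_pow, Real.norm_ofNat]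
    rw [zpow_sub₀ two_ne_zero, zpow_neg, zpow_natCast, zpow_one, div_lt_iff₀ two_pos,
      inv_lt_iff_one_lt_mul₀ h2k, ← one_div, lt_div_iff₀ h2k, div_lt_iff₀ two_pos,
      mul_comm ‖x‖ (2 ^ k), show ‖x‖ * 2 * 2 ^ k = 2 ^ k * ‖x‖ * 2 by ring]

theorem Ik_eq (hn : 2 ≤ n) (hu : SolutionHyp u) {B : ℝ → Matrix (Fin n) (Fin n) ℝ}
    (hB : BProp u B) {t : ℝ} (ht : 0 < t) (k : ℕ) :
    Ik u B k t = (2:ℝ)^(-((k * (n + 2) : ℕ) : ℤ)) *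
      (I0 u B (t + k * Real.log 2) + ∫ z in LamT u (t + k * Real.log 2) ∩ ann0 n,
        ∑ i, ∑ j, (B (t + k * Real.log 2) i j - B t i j) * z i * z j) := by
  set s := t + k * Real.log 2 with hs
  have hs0 : 0 < s := by
    have := Real.log_nonneg (one_le_two (α := ℝ))
    positivity
  have hqc : ∀ M : Matrix (Fin n) (Fin n) ℝ, Continuous (qB M) := fun M => by
    have := continuous_psiM M
    unfold qB p0
    fun_prop
  have hmA : MeasurableSet (ann0 n) := ((isOpen_lt continuous_const continuous_norm).inter
    (isOpen_lt continuous_norm continuous_const)).measurableSet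
  have hmK : MeasurableSet (annK n k) := ((isOpen_lt continuous_const continuous_norm).inter
    (isOpen_lt continuous_norm continuous_const)).measurableSet
  have hsub : LamT u s ∩ ann0 n ⊆ ball 0 1 := fun x hx => by simpa using hx.2.2
  have hI0 : I0 u B s = ∫ x in LamT u s ∩ ann0 n, -(2 * qB (B s) x) :=
    setIntegral_congr_fun ((hu.measurableSet_LamT s).inter hmA) fun x hx =>
      sum_mul_gradient_Rt hu hn (hB s hs0).1.1 hx.1
  have hIk : Ik u B k t = ∫ x in LamT u t ∩ annK n k, -(2 * qB (B t) x) :=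
    setIntegral_congr_fun ((hu.measurableSet_LamT t).inter hmK) fun x hx =>
      sum_mul_gradient_Rt hu hn (hB t ht).1.1 hx.1
  have hpow : (2:ℝ)^(-((k * (n + 2) : ℕ) : ℤ)) = (((2 : ℝ) ^ k)⁻¹) ^ (n + 2) := by
    rw [zpow_neg, zpow_natCast, pow_mul, inv_pow]
  rw [hIk, LamT_inter_annK_eq, setIntegral_smul_of_homogeneous (by positivity), ← hs, hpow, hI0,
    ← integral_add]
  · congr 1
    refine integral_congr_ae (Eventually.of_forall fun x => ?_)
    have h := psiM_sub (B s) (B t) x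
    have h' : ∑ i, ∑ j, (B s i j - B t i j) * x i * x j = 2 * psiM (B s - B t) x := by
      simp [psiM]
    simp only [h', h, qB]
    ring
  · have := hqc (B s)
    exact integrableOn_of_continuous_of_subset_ball (by fun_prop) hsub
  · exact integrableOn_of_continuous_of_subset_ball (by fun_prop) hsub
  · intro x
    rw [qB, qB, psiM_smul, p0_smul]
    ring

end Solution

/-- dyadic scaling identity for I_k and the bound on J_k. -/
theorem stmt_14 (n : ℕ) (hn : 2 ≤ n) :
    ∃ Cn : ℝ, ∀ u : En n → ℝ, SolutionHyp u →
      ∀ B : ℝ → Matrix (Fin n) (Fin n) ℝ, BProp u B →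
        ∀ t : ℝ, 0 < t → ∀ k : ℕ,
          Ik u B k t = (2:ℝ)^(-((k * (n + 2) : ℕ) : ℤ)) *
              (I0 u B (t + k * Real.log 2) +
                ∫ z in LamT u (t + k * Real.log 2) ∩ ann0 n,
                  ∑ i, ∑ j, (B (t + k * Real.log 2) i j - B t i j) * z i * z j) ∧
          |∫ z in LamT u (t + k * Real.log 2) ∩ ann0 n,
              ∑ i, ∑ j, (B (t + k * Real.log 2) i j - B t i j) * z i * z j|
            ≤ Cn * F0 u (t + k * Real.log 2)
                * ∫ τ in t..(t + k * Real.log 2), Fdef u τ := by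
  obtain ⟨κ, hκ, hκD⟩ := exists_pos_mul_entrySum_sq_le n hn
  refine ⟨(2 * κ)⁻¹, fun u hu B hB t ht k => ⟨Ik_eq hn hu hB ht k, ?_⟩⟩
  have hts : t ≤ t + k * Real.log 2 :=
    le_add_of_nonneg_right (mul_nonneg k.cast_nonneg (Real.log_nonneg one_le_two))
  have hF0 : 0 ≤ F0 u (t + k * Real.log 2) := integral_nonneg fun _ => by positivity
  calc _ ≤ entrySum (B (t + k * Real.log 2) - B t) * F0 u (t + k * Real.log 2) :=
        abs_setIntegral_quadratic_le u _ (B (t + k * Real.log 2) - B t)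
    _ ≤ ((2 * κ)⁻¹ * ∫ τ in t..(t + k * Real.log 2), Fdef u τ) * F0 u (t + k * Real.log 2) := by
        gcongr
        exact entrySum_sub_le hn hκ hκD hu hB ht hts
    _ = _ := by ring

end
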